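/- For every constant C ∈ ℕ there exists c > 0 such that the following holds. Let m ≥ 1, let S₀,…,S_m be disjoint subsets of ℤ² with #S_j ≤ 2^j, let λ₀,…,λ_m ≥ 0, and let f = Σ_{j=0}^m λ_j 2^{−j/2} χ_{S_j}. Assume that for each j and each ξ ∈ S_j there exists at most one line ℓ through ξ with #(ℓ ∩ S_j) ≥ 2^{j/2+C}. Then Σ_{Q=(ξ₁,ξ₂,ξ₃,ξ₄) ∈ 𝒬⁰_{2,2}} (1/gcd(ξ₁−ξ₄)) f(Q) ≤ c (Σ_{j=0}^m λ_j²)². -/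

import Mathlib

open scoped BigOperators

noncomputable section

/-- Points of the integer lattice `ℤ²`. -/
abbrev Pt := ℤ × ℤ

/-- A quadruple of lattice points, viewed as a function on `Fin 4`
(indices taken cyclically). -/
abbrev Quad := Fin 4 → Pt

/-- The embedding `ℤ² ↪ ℝ²`. -/
def emb (ξ : Pt) : ℝ × ℝ := ((ξ.1 : ℝ), (ξ.2 : ℝ))

/-- An affine line in the plane `ℝ²`. -/
def IsLine (ℓ : Set (ℝ × ℝ)) : Prop :=
  ∃ p v : ℝ × ℝ, v ≠ 0 ∧ ℓ = {x | ∃ t : ℝ, x = p + t • v}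

/-- The line through two lattice points `p ≠ q` (a degenerate point if `p = q`). -/
def lineThrough (p q : Pt) : Set (ℝ × ℝ) :=
  {x | ∃ t : ℝ, x = emb p + t • (emb q - emb p)}

/-- The number of points of a finite set `T ⊂ ℤ²` on a set `ℓ ⊂ ℝ²`,
i.e. `#(ℓ ∩ T)`. -/
def lineCount (ℓ : Set (ℝ × ℝ)) (T : Finset Pt) : ℕ :=
  (ℓ ∩ (emb '' (T : Set Pt))).ncard

/-- `Q = (ξ₁,ξ₂,ξ₃,ξ₄)` is a parallelogram: `ξ₁ + ξ₃ = ξ₂ + ξ₄`. -/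
def IsPara (Q : Quad) : Prop := Q 0 + Q 2 = Q 1 + Q 3

/-- The dot product `(ξ₁ − ξ₂)·(ξ₁ − ξ₄)`. -/
def dotQ (Q : Quad) : ℤ :=
  ((Q 0).1 - (Q 1).1) * ((Q 0).1 - (Q 3).1) + ((Q 0).2 - (Q 1).2) * ((Q 0).2 - (Q 3).2)

/-- `τ_Q = ||ξ₁|² − |ξ₂|² + |ξ₃|² − |ξ₄|²| = 2|(ξ₁−ξ₂)·(ξ₁−ξ₄)|`. -/
def tauQ (Q : Quad) : ℤ := 2 * |dotQ Q|

/-- `Q` is a rectangle: a parallelogram with `τ_Q = 0`. Membership in `𝒬⁰`. -/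
def IsRect (Q : Quad) : Prop := IsPara Q ∧ dotQ Q = 0

/-- `f(Q) = f(ξ₁)f(ξ₂)f(ξ₃)f(ξ₄)`. -/
def fQ (f : Pt → ℝ) (Q : Quad) : ℝ := ∏ k : Fin 4, f (Q k)

/-- The weight `f = ∑_{j=0}^m λ_j 2^{−j/2} χ_{S_j}`. -/
def fWt (S : ℕ → Finset Pt) (lam : ℕ → ℝ) (m : ℕ) (ξ : Pt) : ℝ :=
  ∑ j ∈ Finset.range (m + 1), if ξ ∈ S j then lam j * (2 : ℝ) ^ (-(j : ℝ) / 2) else 0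

/-- `gcd((a,b)) = gcd(|a|,|b|)` for `(a,b) ∈ ℤ²`. -/
def gcdP (ξ : Pt) : ℕ := Int.gcd ξ.1 ξ.2

/-- `max{#(ℓ(ξ,η₁) ∩ S_j), #(ℓ(ξ,η₂) ∩ S_j)}`, where `η₁, η₂` are the two
neighboring vertices of `ξ` in a rectangle. -/
def crossMax (S : ℕ → Finset Pt) (j : ℕ) (ξ η₁ η₂ : Pt) : ℕ :=
  max (lineCount (lineThrough ξ η₁) (S j)) (lineCount (lineThrough ξ η₂) (S j))

/-- `ξ` lies in some `S_j`, `j ≤ m`, and is a vertex of type `α ∈ {1,2,3}`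
relative to its neighbors `η₁, η₂`: with `a := log₂ crossMax`, type 1 means
`a ≥ j/2 + C` (i.e. `crossMax ≥ 2^{j/2+C}`), type 2 means `1 ≤ a < j/2 + C`
(i.e. `2 ≤ crossMax < 2^{j/2+C}`), and type 3 means `a = 0` (`crossMax = 1`). -/
def VertexType (S : ℕ → Finset Pt) (C m : ℕ) (α : ℕ) (ξ η₁ η₂ : Pt) : Prop :=
  ∃ j ≤ m, ξ ∈ S j ∧
    ((α = 1 ∧ (2 : ℝ) ^ ((j : ℝ) / 2 + (C : ℝ)) ≤ (crossMax S j ξ η₁ η₂ : ℝ)) ∨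
     (α = 2 ∧ 2 ≤ crossMax S j ξ η₁ η₂ ∧
        (crossMax S j ξ η₁ η₂ : ℝ) < (2 : ℝ) ^ ((j : ℝ) / 2 + (C : ℝ))) ∨
     (α = 3 ∧ crossMax S j ξ η₁ η₂ = 1))

/-- The set `𝒬⁰_{α,β}`: rectangles with four distinct vertices, all in
`∪_{j=0}^m S_j`, with `ξ₁, ξ₂` of type `α` and `ξ₃, ξ₄` of type `β`. -/
def QZeroAB (S : ℕ → Finset Pt) (C m : ℕ) (α β : ℕ) : Set Quad :=
  {Q | IsRect Q ∧ Function.Injective Q ∧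
    VertexType S C m α (Q 0) (Q 1) (Q 3) ∧
    VertexType S C m α (Q 1) (Q 2) (Q 0) ∧
    VertexType S C m β (Q 2) (Q 3) (Q 1) ∧
    VertexType S C m β (Q 3) (Q 0) (Q 2)}

/-- The set `𝒬⁰(j⃗, a⃗)`: rectangles with distinct vertices `ξ_k ∈ S_{j_k}` such
that for each `k` (cyclically), `2^{a_k} ≤ max{#(ℓ(ξ_k,ξ_{k+1}) ∩ S_{j_k}),
#(ℓ(ξ_k,ξ_{k−1}) ∩ S_{j_k})} < 2^{a_k+1}`. -/
def QZeroJA (S : ℕ → Finset Pt) (j a : Fin 4 → ℕ) : Set Quad :=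
  {Q | IsRect Q ∧ Function.Injective Q ∧ (∀ k, Q k ∈ S (j k)) ∧
    ∀ k : Fin 4,
      2 ^ (a k) ≤ max (lineCount (lineThrough (Q k) (Q (k + 1))) (S (j k)))
          (lineCount (lineThrough (Q k) (Q (k - 1))) (S (j k))) ∧
        max (lineCount (lineThrough (Q k) (Q (k + 1))) (S (j k)))
          (lineCount (lineThrough (Q k) (Q (k - 1))) (S (j k))) < 2 ^ (a k + 1)}



section GeometricGraph

variable {α : Type*} (X Y : α → ℝ)

/-- The slope of the segment joining the endpoints of `e`. -/
def segSlope (e : α × α) : ℝ := (Y e.2 - Y e.1) / (X e.2 - X e.1)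

/-- The height over `x` of the line through the endpoints of `e`. -/
def segHeight (e : α × α) (x : ℝ) : ℝ := Y e.1 + segSlope X Y e * (x - X e.1)

/-- The relative interiors of two non-vertical segments meet. -/
def SegCross (e f : α × α) : Prop :=
  ∃ x, X e.1 < x ∧ X f.1 < x ∧ x < X e.2 ∧ x < X f.2 ∧ segHeight X Y e x = segHeight X Y f x

/-- A straight-line graph whose edges point to the right and avoid the other vertices. -/
structure IsSegGraph (P : Finset α) (E : Finset (α × α)) : Prop where
  injOn : Set.InjOn X P
  left_mem : ∀ e ∈ E, e.1 ∈ P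
  right_mem : ∀ e ∈ E, e.2 ∈ P
  lt : ∀ e ∈ E, X e.1 < X e.2
  avoid : ∀ e ∈ E, ∀ z ∈ P, X e.1 < X z → X z < X e.2 → segHeight X Y e (X z) ≠ Y z

/-- `e'` is the edge following `e` in the counterclockwise order among the edges with the same
left endpoint, and `z` is the first vertex met between them. -/
structure IsWedge (P : Finset α) (E : Finset (α × α)) (e e' : α × α) (z : α) : Prop where
  mem : e ∈ E
  mem' : e' ∈ E
  left_eq : e'.1 = e.1
  slope_lt : segSlope X Y e < segSlope X Y e'
  slope_le : ∀ g ∈ E, g.1 = e.1 → segSlope X Y e < segSlope X Y g →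
    segSlope X Y e' ≤ segSlope X Y g
  tip_mem : z ∈ P
  lt_tip : X e.1 < X z
  tip_le : X z ≤ X e.2
  tip_le' : X z ≤ X e'.2
  le_tip : segHeight X Y e (X z) ≤ Y z
  tip_le_height : Y z ≤ segHeight X Y e' (X z)
  first : ∀ t ∈ P, X e.1 < X t → X t < X z → segHeight X Y e (X t) ≤ Y t →
    Y t ≤ segHeight X Y e' (X t) → False

variable {X Y} {P : Finset α} {E : Finset (α × α)}

lemma SegCross.symm {e f : α × α} (h : SegCross X Y e f) : SegCross X Y f e := by
  obtain ⟨x, h1, h2, h3, h4, h5⟩ := h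
  exact ⟨x, h2, h1, h4, h3, h5.symm⟩

lemma segHeight_left (e : α × α) : segHeight X Y e (X e.1) = Y e.1 := by
  simp [segHeight]

lemma segHeight_right {e : α × α} (h : X e.1 < X e.2) : segHeight X Y e (X e.2) = Y e.2 := by
  have : X e.2 - X e.1 ≠ 0 := (sub_pos.2 h).ne'
  simp only [segHeight, segSlope]
  field_simp
  ring

lemma segHeight_sub (e : α × α) (x y : ℝ) :
    segHeight X Y e x = segHeight X Y e y + segSlope X Y e * (x - y) := by
  simp only [segHeight]; ring

lemma continuous_segHeight (e : α × α) : Continuous (segHeight X Y e) := by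
  unfold segHeight; fun_prop

lemma exists_segHeight_eq (e f : α × α) {x₁ x₂ : ℝ} (hx : x₁ ≤ x₂)
    (h₁ : segHeight X Y e x₁ ≤ segHeight X Y f x₁) (h₂ : segHeight X Y f x₂ ≤ segHeight X Y e x₂) :
    ∃ x, x₁ ≤ x ∧ x ≤ x₂ ∧ segHeight X Y e x = segHeight X Y f x := by
  have hc : ContinuousOn (fun x => segHeight X Y e x - segHeight X Y f x) (Set.Icc x₁ x₂) :=
    ((continuous_segHeight e).sub (continuous_segHeight f)).continuousOn
  obtain ⟨x, hx, h⟩ := intermediate_value_Icc hx hc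
    (show (0 : ℝ) ∈ Set.Icc _ _ from ⟨by linarith, by linarith⟩)
  exact ⟨x, hx.1, hx.2, sub_eq_zero.mp h⟩

/-- Two edges that do not cross keep their vertical order. -/
lemma segHeight_le_of_not_cross {e f : α × α} {x₁ x₂ : ℝ} (hef : ¬ SegCross X Y e f)
    (he₁ : X e.1 ≤ x₁) (hf₁ : X f.1 ≤ x₁) (hx : x₁ ≤ x₂) (he₂ : x₂ ≤ X e.2) (hf₂ : x₂ ≤ X f.2)
    (h : segHeight X Y e x₂ < segHeight X Y f x₂) :
    segHeight X Y e x₁ ≤ segHeight X Y f x₁ := by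
  by_contra! hlt
  obtain ⟨x, h1, h2, h3⟩ := exists_segHeight_eq f e hx hlt.le h.le
  have h1' : x₁ < x := lt_of_le_of_ne h1 (by rintro rfl; linarith)
  have h2' : x < x₂ := lt_of_le_of_ne h2 (by rintro rfl; linarith)
  exact hef ⟨x, by linarith, by linarith, by linarith, by linarith, h3.symm⟩

lemma segHeight_lt_of_not_cross {e f : α × α} {x₁ x₂ : ℝ} (hef : ¬ SegCross X Y e f)
    (he₁ : X e.1 < x₁) (hf₁ : X f.1 < x₁) (hx : x₁ < x₂) (he₂ : x₂ ≤ X e.2) (hf₂ : x₂ ≤ X f.2)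
    (h : segHeight X Y e x₂ < segHeight X Y f x₂) :
    segHeight X Y e x₁ < segHeight X Y f x₁ :=
  lt_of_le_of_ne (segHeight_le_of_not_cross hef he₁.le hf₁.le hx.le he₂ hf₂ h) fun h' =>
    hef ⟨x₁, he₁, hf₁, by linarith, by linarith, h'⟩

lemma IsWedge.not_between (hG : IsSegGraph X Y P E)
    (hc : ∀ e ∈ E, ∀ f ∈ E, e ≠ f → ¬ SegCross X Y e f) {f f' g : α × α} {z : α}
    (hw : IsWedge X Y P E f f' z) (hg : g ∈ E) {x : ℝ} (hgx : X g.1 < x) (hxg : x ≤ X g.2)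
    (hfx : X f.1 < x) (hxz : x ≤ X z) (h : segHeight X Y f x < segHeight X Y g x)
    (h' : segHeight X Y g x < segHeight X Y f' x) : False := by
  have hfg : ¬ SegCross X Y f g := hc f hw.mem g hg (by rintro rfl; exact h.false)
  have hgf : ¬ SegCross X Y g f' := hc g hg f' hw.mem' (by rintro rfl; exact h'.false)
  have hl := hw.left_eq
  have hz := hw.tip_le
  have hz' := hw.tip_le'
  have hX' : X f'.1 = X f.1 := by rw [hl]
  rcases le_or_gt (X g.1) (X f.1) with hle | hlt
  · have h1 := segHeight_le_of_not_cross hfg le_rfl hle hfx.le (by linarith) hxg h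
    have h2 := segHeight_le_of_not_cross hgf hle hX'.le hfx.le hxg (by linarith) h'
    have h3 : segHeight X Y f' (X f.1) = Y f.1 := by rw [← hl, segHeight_left]
    rw [segHeight_left] at h1
    have h4 : segHeight X Y g (X f.1) = Y f.1 := by linarith
    rcases hle.lt_or_eq with hlt | heq
    · exact hG.avoid g hg f.1 (hG.left_mem f hw.mem) hlt (by linarith) h4
    · have hgf1 : g.1 = f.1 := hG.injOn (hG.left_mem g hg) (hG.left_mem f hw.mem) heq
      have hpos : 0 < x - X f.1 := by linarith
      simp only [segHeight, hl, hgf1] at h h'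
      have h5 : segSlope X Y f < segSlope X Y g := by
        by_contra! hh; nlinarith
      have h6 := hw.slope_le g hg hgf1 h5
      nlinarith
  · have h1 := segHeight_le_of_not_cross hfg hlt.le le_rfl hgx.le (by linarith) hxg h
    have h2 := segHeight_le_of_not_cross hgf le_rfl (by linarith) hgx.le hxg (by linarith) h'
    rw [segHeight_left] at h1 h2
    exact hw.first g.1 (hG.left_mem g hg) hlt (by linarith) h1 h2

lemma IsWedge.height_lt {f f' : α × α} {z : α} (hw : IsWedge X Y P E f f' z) :
    segHeight X Y f (X z) < segHeight X Y f' (X z) := by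
  have h := hw.slope_lt
  have h1 : 0 < X z - X f.1 := by linarith [hw.lt_tip]
  simp only [segHeight, hw.left_eq]
  nlinarith

/-- Two non-crossing edges with a common right endpoint have different slopes. -/
lemma segSlope_ne_of_right {e f : α × α} (hef : ¬ SegCross X Y e f) (he : X e.1 < X e.2)
    (hf : X f.1 < X f.2) (h : e.2 = f.2) : segSlope X Y e ≠ segSlope X Y f := by
  intro hs
  have hX : X f.2 = X e.2 := by rw [h]
  have hm : max (X e.1) (X f.1) < X e.2 := max_lt he (by linarith)
  obtain ⟨x, h1, h2⟩ := exists_between hm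
  have h3 : segHeight X Y e (X e.2) = segHeight X Y f (X e.2) := by
    rw [segHeight_right he, ← hX, segHeight_right hf, h]
  exact hef ⟨x, (le_max_left _ _).trans_lt h1, (le_max_right _ _).trans_lt h1, h2, by linarith, by
    rw [segHeight_sub e x (X e.2), segHeight_sub f x (X e.2), h3, hs]⟩

lemma segSlope_ne_of_left {e f : α × α} (hef : ¬ SegCross X Y e f) (he : X e.1 < X e.2)
    (hf : X f.1 < X f.2) (h : e.1 = f.1) : segSlope X Y e ≠ segSlope X Y f := by
  intro hs
  have hX : X f.1 = X e.1 := by rw [h]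
  obtain ⟨x, h1, h2⟩ := exists_between (lt_min he (hX ▸ hf))
  exact hef ⟨x, h1, by linarith, h2.trans_le (min_le_left _ _), h2.trans_le (min_le_right _ _), by
    simp only [segHeight, hs, h]⟩

/-- The lower edges of two wedges do not end at the same tip. -/
lemma IsWedge.false_of_lower (hG : IsSegGraph X Y P E)
    (hc : ∀ e ∈ E, ∀ f ∈ E, e ≠ f → ¬ SegCross X Y e f) {e f f' : α × α} {z : α}
    (he : e ∈ E) (hez : e.2 = z) (hw : IsWedge X Y P E f f' z) (hfz : f.2 = z)
    (hs : segSlope X Y e < segSlope X Y f) : False := by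
  subst hez
  have hX : X f.2 = X e.2 := by rw [hfz]
  have hlt := hG.lt e he
  have hlt' := hG.lt f hw.mem
  have hm : max (X e.1) (X f.1) < X e.2 := max_lt hlt (by linarith)
  obtain ⟨x, h1, h2⟩ := exists_between hm
  have h3 := (le_max_left _ _).trans_lt h1
  have h4 := (le_max_right _ _).trans_lt h1
  have h5 : segHeight X Y e (X e.2) = segHeight X Y f (X e.2) := by
    rw [segHeight_right hlt, ← hX, segHeight_right hlt', hfz]
  have h6 : segHeight X Y e (X e.2) < segHeight X Y f' (X e.2) := by
    rw [h5]; exact hw.height_lt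
  have hne : e ≠ f' := by rintro rfl; exact h6.false
  have h7 := segHeight_lt_of_not_cross (hc e he f' hw.mem' hne) h3 (by rw [hw.left_eq]; exact h4)
    h2 le_rfl hw.tip_le' h6
  refine hw.not_between hG hc he h3 h2.le h4 h2.le ?_ h7
  rw [segHeight_sub e x (X e.2), segHeight_sub f x (X e.2), h5]
  nlinarith

/-- The upper edges of two wedges do not end at the same tip. -/
lemma IsWedge.false_of_upper (hG : IsSegGraph X Y P E)
    (hc : ∀ e ∈ E, ∀ f ∈ E, e ≠ f → ¬ SegCross X Y e f) {e f f' : α × α} {z : α}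
    (he : e ∈ E) (hez : e.2 = z) (hw : IsWedge X Y P E f f' z) (hfz : f'.2 = z)
    (hs : segSlope X Y f' < segSlope X Y e) : False := by
  subst hez
  have hX : X f'.2 = X e.2 := by rw [hfz]
  have hl : X f'.1 = X f.1 := by rw [hw.left_eq]
  have hlt := hG.lt e he
  have hlt' := hG.lt f' hw.mem'
  have hm : max (X e.1) (X f.1) < X e.2 := max_lt hlt (by linarith)
  obtain ⟨x, h1, h2⟩ := exists_between hm
  have h3 := (le_max_left _ _).trans_lt h1
  have h4 := (le_max_right _ _).trans_lt h1
  have h5 : segHeight X Y e (X e.2) = segHeight X Y f' (X e.2) := by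
    rw [segHeight_right hlt, ← hX, segHeight_right hlt', hfz]
  have h6 : segHeight X Y f (X e.2) < segHeight X Y e (X e.2) := by
    rw [h5]; exact hw.height_lt
  have hne : f ≠ e := by rintro rfl; exact h6.false
  have h7 := segHeight_lt_of_not_cross (hc f hw.mem e he hne) h4 h3 h2 hw.tip_le le_rfl h6
  refine hw.not_between hG hc he h3 h2.le h4 h2.le h7 ?_
  rw [segHeight_sub e x (X e.2), segHeight_sub f' x (X e.2), h5]
  nlinarith

lemma IsSegGraph.exists_isWedge (hG : IsSegGraph X Y P E) {e : α × α} (he : e ∈ E)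
    (h : ∃ g ∈ E, g.1 = e.1 ∧ segSlope X Y e < segSlope X Y g) :
    ∃ e' z, IsWedge X Y P E e e' z := by
  classical
  obtain ⟨g, hg, hg1, hgs⟩ := h
  obtain ⟨e', he', hmin⟩ := Finset.exists_min_image
    (E.filter fun g => g.1 = e.1 ∧ segSlope X Y e < segSlope X Y g) (segSlope X Y)
    ⟨g, by simp [hg, hg1, hgs]⟩
  simp only [Finset.mem_filter, and_imp] at he' hmin
  obtain ⟨hE', hl, hs⟩ := he'
  have hX : X e'.1 = X e.1 := by rw [hl]
  have hlt := hG.lt e he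
  have hlt' := hG.lt e' hE'
  have key : ∀ x, X e.1 < x → segHeight X Y e x < segHeight X Y e' x := by
    intro x hx
    simp only [segHeight, hl]
    nlinarith
  obtain ⟨z, hz, hzmin⟩ := Finset.exists_min_image
    (P.filter fun z => X e.1 < X z ∧ X z ≤ X e.2 ∧ X z ≤ X e'.2 ∧ segHeight X Y e (X z) ≤ Y z ∧
      Y z ≤ segHeight X Y e' (X z)) X (by
      rcases le_total (X e.2) (X e'.2) with hh | hh
      · refine ⟨e.2, ?_⟩
        have := key _ hlt
        rw [segHeight_right hlt] at this
        simp [hG.right_mem e he, hlt, hh, segHeight_right hlt, this.le]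
      · refine ⟨e'.2, ?_⟩
        have := key _ (hX ▸ hlt')
        rw [segHeight_right hlt'] at this
        simp [hG.right_mem e' hE', hX ▸ hlt', hh, segHeight_right hlt', this.le])
  simp only [Finset.mem_filter, and_imp] at hz hzmin
  obtain ⟨hzP, h1, h2, h3, h4, h5⟩ := hz
  refine ⟨e', z, he, hE', hl, hs, hmin, hzP, h1, h2, h3, h4, h5, ?_⟩
  intro t ht h6 h7 h8 h9
  have := hzmin t ht h6 (by linarith) (by linarith) h8 h9
  linarith

lemma IsWedge.tip_eq (hG : IsSegGraph X Y P E) {e : α × α} {z : α} (he : e ∈ E) (hz : z ∈ P)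
    (h₁ : X e.1 < X z) (h₂ : X z ≤ X e.2) (h : segHeight X Y e (X z) = Y z) : e.2 = z := by
  refine hG.injOn (hG.right_mem e he) hz (le_antisymm ?_ h₂)
  by_contra! hlt
  exact hG.avoid e he z hz h₁ hlt h

/-- Wedges with the same tip, hit in the same way, coincide. -/
lemma IsWedge.unique (hG : IsSegGraph X Y P E)
    (hc : ∀ e ∈ E, ∀ f ∈ E, e ≠ f → ¬ SegCross X Y e f) {e e' f f' : α × α} {z : α}
    (he : IsWedge X Y P E e e' z) (hf : IsWedge X Y P E f f' z)
    (h₁ : segHeight X Y e (X z) = Y z ↔ segHeight X Y f (X z) = Y z)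
    (h₂ : segHeight X Y e' (X z) = Y z ↔ segHeight X Y f' (X z) = Y z) : e = f := by
  by_contra hne
  have hef := hc e he.mem f hf.mem hne
  have lt_e := hG.lt e he.mem
  have lt_f := hG.lt f hf.mem
  have lt_e' := hG.lt e' he.mem'
  have lt_f' := hG.lt f' hf.mem'
  have hle : X e'.1 < X z := by rw [he.left_eq]; exact he.lt_tip
  have hlf : X f'.1 < X z := by rw [hf.left_eq]; exact hf.lt_tip
  by_cases h : segHeight X Y e (X z) = Y z
  · have hez := IsWedge.tip_eq hG he.mem he.tip_mem he.lt_tip he.tip_le h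
    have hfz := IsWedge.tip_eq hG hf.mem hf.tip_mem hf.lt_tip hf.tip_le (h₁.1 h)
    rcases (segSlope_ne_of_right hef lt_e lt_f (hez.trans hfz.symm)).lt_or_gt with hs | hs
    · exact hf.false_of_lower hG hc he.mem hez hfz hs
    · exact he.false_of_lower hG hc hf.mem hfz hez hs
  by_cases h' : segHeight X Y e' (X z) = Y z
  · have hez := IsWedge.tip_eq hG he.mem' he.tip_mem hle he.tip_le' h'
    have hfz := IsWedge.tip_eq hG hf.mem' hf.tip_mem hlf hf.tip_le' (h₂.1 h')
    by_cases hne' : e' = f'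
    · have hl : e.1 = f.1 := by rw [← he.left_eq, ← hf.left_eq, hne']
      rcases (segSlope_ne_of_left hef lt_e lt_f hl).lt_or_gt with hs | hs
      · have := he.slope_le f hf.mem hl.symm hs
        rw [hne'] at this
        exact this.not_gt hf.slope_lt
      · have := hf.slope_le e he.mem hl hs
        rw [← hne'] at this
        exact this.not_gt he.slope_lt
    · rcases (segSlope_ne_of_right (hc _ he.mem' _ hf.mem' hne') lt_e' lt_f'
        (hez.trans hfz.symm)).lt_or_gt with hs | hs
      · exact he.false_of_upper hG hc hf.mem' hfz hez hs
      · exact hf.false_of_upper hG hc he.mem' hez hfz hs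
  have a1 := lt_of_le_of_ne he.le_tip h
  have a2 := lt_of_le_of_ne hf.le_tip (h₁.not.1 h)
  have a3 := lt_of_le_of_ne he.tip_le_height (Ne.symm h')
  have a4 := lt_of_le_of_ne hf.tip_le_height (Ne.symm (h₂.not.1 h'))
  have b1 : X z < X e.2 := lt_of_le_of_ne he.tip_le fun hh => h (by
    have := hG.injOn he.tip_mem (hG.right_mem e he.mem) hh
    rw [this, segHeight_right lt_e])
  have b2 : X z < X f.2 := lt_of_le_of_ne hf.tip_le fun hh => (h₁.not.1 h) (by
    have := hG.injOn hf.tip_mem (hG.right_mem f hf.mem) hh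
    rw [this, segHeight_right lt_f])
  rcases lt_trichotomy (segHeight X Y e (X z)) (segHeight X Y f (X z)) with hh | hh | hh
  · exact he.not_between hG hc hf.mem hf.lt_tip b2.le he.lt_tip le_rfl hh (by linarith)
  · exact hef ⟨X z, he.lt_tip, hf.lt_tip, b1, b2, hh⟩
  · exact hf.not_between hG hc he.mem he.lt_tip b1.le hf.lt_tip le_rfl hh (by linarith)

/-- A straight-line graph without crossings has linearly many edges. -/
theorem IsSegGraph.card_le_of_not_cross (hG : IsSegGraph X Y P E)
    (hc : ∀ e ∈ E, ∀ f ∈ E, e ≠ f → ¬ SegCross X Y e f) : E.card ≤ 5 * P.card := by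
  classical
  have htop : (E.filter fun e => ¬ ∃ g ∈ E, g.1 = e.1 ∧ segSlope X Y e < segSlope X Y g).card ≤
      P.card := by
    refine Finset.card_le_card_of_injOn Prod.fst ?_ ?_
    · intro e he
      exact hG.left_mem e (Finset.mem_filter.1 he).1
    · intro e he f hf hl
      simp only [Finset.coe_filter, Set.mem_ofPred_eq, not_exists, not_and, not_lt] at he hf
      by_contra hne
      exact segSlope_ne_of_left (hc e he.1 f hf.1 hne) (hG.lt e he.1) (hG.lt f hf.1) hl
        (le_antisymm (hf.2 e he.1 hl) (he.2 f hf.1 hl.symm))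
  have hrest : (E.filter fun e => ∃ g ∈ E, g.1 = e.1 ∧ segSlope X Y e < segSlope X Y g).card ≤
      (P ×ˢ (Finset.univ : Finset (Bool × Bool))).card := by
    have hex : ∀ e, ∃ q : (α × α) × α, (e ∈ E ∧ ∃ g ∈ E, g.1 = e.1 ∧
        segSlope X Y e < segSlope X Y g) → IsWedge X Y P E e q.1 q.2 := by
      intro e
      by_cases h : e ∈ E ∧ ∃ g ∈ E, g.1 = e.1 ∧ segSlope X Y e < segSlope X Y g
      · obtain ⟨e', z, hw⟩ := hG.exists_isWedge h.1 h.2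
        exact ⟨(e', z), fun _ => hw⟩
      · exact ⟨(e, e.1), fun h' => absurd h' h⟩
    choose q hq using hex
    refine Finset.card_le_card_of_injOn (fun e => ((q e).2,
      (decide (segHeight X Y e (X (q e).2) = Y (q e).2),
        decide (segHeight X Y (q e).1 (X (q e).2) = Y (q e).2)))) ?_ ?_
    · intro e he
      simpa using (hq e (Finset.mem_filter.1 he)).tip_mem
    · intro e he f hf h
      simp only [Prod.mk.injEq, decide_eq_decide] at h
      have hwe := hq e (Finset.mem_filter.1 he)
      have hwf := hq f (Finset.mem_filter.1 hf)
      rw [← h.1] at hwf h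
      exact hwe.unique hG hc hwf h.2.1 h.2.2
  rw [Finset.card_product] at hrest
  have hcard : (Finset.univ : Finset (Bool × Bool)).card = 4 := rfl
  rw [hcard] at hrest
  have := Finset.card_filter_add_card_filter_not (s := E)
    (fun e => ∃ g ∈ E, g.1 = e.1 ∧ segSlope X Y e < segSlope X Y g)
  omega

/-- In a random subset of `P` that contains each point independently with probability `p`, a fixed
set `A` is contained with probability `p ^ #A`. -/
lemma sum_powerset_weight [DecidableEq α] {A : Finset α} (hA : A ⊆ P) (p : ℝ) :
    ∑ T ∈ P.powerset, p ^ T.card * (1 - p) ^ (P \ T).card * (if A ⊆ T then 1 else 0) =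
      p ^ A.card := by
  have h := Finset.prod_add (fun _ : α => p) (fun i => if i ∈ A then 0 else 1 - p) P
  have h1 : ∏ i ∈ P, (p + if i ∈ A then 0 else 1 - p) = p ^ A.card := by
    rw [← Finset.prod_const, ← Finset.prod_sdiff hA]
    rw [Finset.prod_eq_one, one_mul]
    · exact Finset.prod_congr rfl fun i hi => by simp [hi]
    · intro i hi
      simp [(Finset.mem_sdiff.1 hi).2]
  rw [h1] at h
  rw [h]
  refine Finset.sum_congr rfl fun T hT => ?_
  rw [Finset.prod_const, mul_assoc]
  congr 1
  split_ifs with hAT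
  · rw [mul_one, ← Finset.prod_const]
    refine Finset.prod_congr rfl fun i hi => ?_
    rw [if_neg fun hiA => (Finset.mem_sdiff.1 hi).2 (hAT hiA)]
  · obtain ⟨i, hi, hiT⟩ := Finset.not_subset.1 hAT
    rw [mul_zero, Finset.prod_eq_zero (i := i)]
    · exact Finset.mem_sdiff.2 ⟨hA hi, hiT⟩
    · simp [hi]

open Classical in
/-- The ordered pairs of crossing edges. -/
def crossings (X Y : α → ℝ) (E : Finset (α × α)) : Finset ((α × α) × (α × α)) :=
  (E ×ˢ E).filter fun q => q.1 ≠ q.2 ∧ SegCross X Y q.1 q.2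

lemma IsSegGraph.card_le_add_crossings (hG : IsSegGraph X Y P E) :
    E.card ≤ 5 * P.card + (crossings X Y E).card := by
  classical
  have h1 : (E.filter fun e => ¬ ∃ f ∈ E, e ≠ f ∧ SegCross X Y e f).card ≤ 5 * P.card := by
    refine IsSegGraph.card_le_of_not_cross (X := X) (Y := Y) ⟨hG.injOn, ?_, ?_, ?_, ?_⟩ ?_
    · exact fun e he => hG.left_mem e (Finset.mem_filter.1 he).1
    · exact fun e he => hG.right_mem e (Finset.mem_filter.1 he).1
    · exact fun e he => hG.lt e (Finset.mem_filter.1 he).1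
    · exact fun e he => hG.avoid e (Finset.mem_filter.1 he).1
    · intro e he f hf hne hcr
      exact (Finset.mem_filter.1 he).2 ⟨f, (Finset.mem_filter.1 hf).1, hne, hcr⟩
  have h2 : (E.filter fun e => ∃ f ∈ E, e ≠ f ∧ SegCross X Y e f).card ≤
      (crossings X Y E).card := by
    refine (Finset.card_le_card fun e he => ?_).trans (Finset.card_image_le (f := Prod.fst))
    obtain ⟨he, f, hf, hne, hcr⟩ := Finset.mem_filter.1 he
    exact Finset.mem_image.2 ⟨(e, f), by simp [crossings, he, hf, hne, hcr], rfl⟩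
  have := Finset.card_filter_add_card_filter_not (s := E)
    (fun e => ∃ f ∈ E, e ≠ f ∧ SegCross X Y e f)
  omega

lemma IsSegGraph.sq_mul_card_le (hG : IsSegGraph X Y P E)
    (hs : ∀ e ∈ E, ∀ f ∈ E, e ≠ f → SegCross X Y e f → e.1 ≠ f.1 ∧ e.2 ≠ f.2)
    {p : ℝ} (hp : 0 ≤ p) (hp1 : p ≤ 1) :
    p ^ 2 * E.card ≤ 5 * (p * P.card) + p ^ 4 * (crossings X Y E).card := by
  classical
  set w : Finset α → ℝ := fun T => p ^ T.card * (1 - p) ^ (P \ T).card with hw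
  have hw0 : ∀ T, 0 ≤ w T := fun T =>
    mul_nonneg (pow_nonneg hp _) (pow_nonneg (by linarith) _)
  have hT : ∀ T ∈ P.powerset, w T * (∑ e ∈ E, if {e.1, e.2} ⊆ T then (1 : ℝ) else 0) ≤
      w T * (5 * (∑ z ∈ P, if {z} ⊆ T then 1 else 0) +
        ∑ q ∈ crossings X Y E, if {q.1.1, q.1.2, q.2.1, q.2.2} ⊆ T then 1 else 0) := by
    intro T hT
    rw [Finset.mem_powerset] at hT
    refine mul_le_mul_of_nonneg_left ?_ (hw0 T)
    have hGT : IsSegGraph X Y T (E.filter fun e => {e.1, e.2} ⊆ T) := by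
      refine ⟨hG.injOn.mono hT, ?_, ?_, ?_, ?_⟩
      · exact fun e he => (Finset.mem_filter.1 he).2 (by simp)
      · exact fun e he => (Finset.mem_filter.1 he).2 (by simp)
      · exact fun e he => hG.lt e (Finset.mem_filter.1 he).1
      · exact fun e he z hz => hG.avoid e (Finset.mem_filter.1 he).1 z (hT hz)
    have h := hGT.card_le_add_crossings
    have h1 : crossings X Y (E.filter fun e => {e.1, e.2} ⊆ T) ⊆
        (crossings X Y E).filter fun q => {q.1.1, q.1.2, q.2.1, q.2.2} ⊆ T := by
      intro q hq
      simp only [crossings, Finset.mem_filter, Finset.mem_product, Finset.insert_subset_iff,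
        Finset.singleton_subset_iff] at hq ⊢
      tauto
    have h2 := h.trans (Nat.add_le_add_left (Finset.card_le_card h1) _)
    have h3 : (P.filter fun z => {z} ⊆ T) = T := by
      ext z
      simp only [Finset.mem_filter, Finset.singleton_subset_iff]
      exact ⟨fun h => h.2, fun h => ⟨hT h, h⟩⟩
    simp only [Finset.sum_boole, h3]
    exact_mod_cast h2
  have hsum := Finset.sum_le_sum hT
  simp only [mul_add, Finset.sum_add_distrib, Finset.mul_sum] at hsum
  rw [Finset.sum_comm, Finset.sum_comm (s := P.powerset) (t := P),
    Finset.sum_comm (s := P.powerset) (t := crossings X Y E)] at hsum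
  have e1 : ∀ e ∈ E, ∑ T ∈ P.powerset, w T * (if {e.1, e.2} ⊆ T then (1 : ℝ) else 0) = p ^ 2 := by
    intro e he
    have hne : e.1 ≠ e.2 := fun h => (hG.lt e he).ne (by rw [h])
    rw [hw, sum_powerset_weight, Finset.card_pair hne]
    simp [Finset.insert_subset_iff, hG.left_mem e he, hG.right_mem e he]
  have e2 : ∀ z ∈ P, ∑ T ∈ P.powerset, w T * (5 * (if {z} ⊆ T then (1 : ℝ) else 0)) = 5 * p := by
    intro z hz
    have := sum_powerset_weight (A := {z}) (Finset.singleton_subset_iff.2 hz) p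
    rw [Finset.card_singleton, pow_one] at this
    rw [← this, Finset.mul_sum]
    exact Finset.sum_congr rfl fun T _ => by ring
  have e3 : ∀ q ∈ crossings X Y E, ∑ T ∈ P.powerset,
      w T * (if {q.1.1, q.1.2, q.2.1, q.2.2} ⊆ T then (1 : ℝ) else 0) = p ^ 4 := by
    rintro ⟨e, f⟩ hq
    simp only [crossings, Finset.mem_filter, Finset.mem_product] at hq
    obtain ⟨⟨he, hf⟩, hne, hcr⟩ := hq
    obtain ⟨h1, h2⟩ := hs e he f hf hne hcr
    obtain ⟨x, a1, a2, a3, a4, -⟩ := hcr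
    have h3 : e.1 ≠ e.2 := fun h => (hG.lt e he).ne (by rw [h])
    have h4 : f.1 ≠ f.2 := fun h => (hG.lt f hf).ne (by rw [h])
    have h5 : e.1 ≠ f.2 := by intro h; rw [h] at a1; linarith
    have h6 : e.2 ≠ f.1 := by intro h; rw [h] at a3; linarith
    rw [hw, sum_powerset_weight]
    · rw [Finset.card_insert_of_notMem, Finset.card_insert_of_notMem, Finset.card_pair h4]
      · simp [h2, h6]
      · simp [h3, h1, h5]
    · simp [Finset.insert_subset_iff, hG.left_mem e he, hG.right_mem e he, hG.left_mem f hf,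
        hG.right_mem f hf]
  rw [Finset.sum_congr rfl e1, Finset.sum_congr rfl e2, Finset.sum_congr rfl e3] at hsum
  simp only [Finset.sum_const, nsmul_eq_mul] at hsum
  linarith

/-- The crossing inequality. -/
theorem IsSegGraph.card_pow_three_le (hG : IsSegGraph X Y P E)
    (hs : ∀ e ∈ E, ∀ f ∈ E, e ≠ f → SegCross X Y e f → e.1 ≠ f.1 ∧ e.2 ≠ f.2)
    (h : 10 * P.card ≤ E.card) :
    (E.card : ℝ) ^ 3 ≤ 200 * (P.card : ℝ) ^ 2 * (crossings X Y E).card := by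
  rcases E.card.eq_zero_or_pos with h0 | h0
  · rw [h0, Nat.cast_zero, zero_pow three_ne_zero]; positivity
  have he : (0 : ℝ) < E.card := by exact_mod_cast h0
  have hn : (0 : ℝ) < P.card := by
    obtain ⟨e, he⟩ := Finset.card_pos.1 h0
    exact_mod_cast Finset.card_pos.2 ⟨_, hG.left_mem e he⟩
  have h' : 10 * (P.card : ℝ) ≤ E.card := by exact_mod_cast h
  have := hG.sq_mul_card_le hs (p := 10 * P.card / E.card) (by positivity)
    (by rw [div_le_one he]; exact h')
  generalize (E.card : ℝ) = e at *
  generalize (P.card : ℝ) = n at *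
  generalize ((crossings X Y E).card : ℝ) = r at *
  have h1 : (10 * n / e) ^ 2 * e - 5 * (10 * n / e * n) = 50 * n ^ 2 / e := by
    field_simp; ring
  have h2 : 50 * n ^ 2 / e ≤ (10 * n / e) ^ 4 * r := by linarith
  have h3 : (10 * n / e) ^ 4 * r = 10000 * n ^ 4 * r / e ^ 4 := by
    field_simp; ring
  rw [h3, div_le_div_iff₀ he (by positivity)] at h2
  have h4 : (50 * n ^ 2 * e) * e ^ 3 ≤ (50 * n ^ 2 * e) * (200 * n ^ 2 * r) := by linarith
  exact le_of_mul_le_mul_left h4 (by positivity)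

end GeometricGraph

section RichLines

/-- The determinant of two lattice vectors. -/
def cross2 (a b : Pt) : ℤ := a.1 * b.2 - a.2 * b.1

/-- The points of `A` on the line through `ξ` and `η`. -/
def linePts (A : Finset Pt) (ξ η : Pt) : Finset Pt :=
  A.filter fun z => cross2 (η - ξ) (z - ξ) = 0

lemma mem_linePts {A : Finset Pt} {ξ η z : Pt} :
    z ∈ linePts A ξ η ↔ z ∈ A ∧ cross2 (η - ξ) (z - ξ) = 0 := by
  simp [linePts]

lemma left_mem_linePts {A : Finset Pt} {ξ : Pt} (η : Pt) (h : ξ ∈ A) : ξ ∈ linePts A ξ η :=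
  mem_linePts.2 ⟨h, by simp [cross2]⟩

lemma right_mem_linePts {A : Finset Pt} {η : Pt} (ξ : Pt) (h : η ∈ A) : η ∈ linePts A ξ η :=
  mem_linePts.2 ⟨h, by simp [cross2, mul_comm]⟩

lemma cross2_eq_zero_trans {a b e : Pt} (he : e ≠ 0) (ha : cross2 e a = 0) (hb : cross2 e b = 0) :
    cross2 a b = 0 := by
  unfold cross2 at *
  have h1 : e.1 * (a.1 * b.2 - a.2 * b.1) = 0 := by linear_combination a.1 * hb - b.1 * ha
  have h2 : e.2 * (a.1 * b.2 - a.2 * b.1) = 0 := by linear_combination a.2 * hb - b.2 * ha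
  by_contra h
  exact he (Prod.ext ((mul_eq_zero.1 h1).resolve_right h) ((mul_eq_zero.1 h2).resolve_right h))

lemma cross2_comm_eq_zero {a b : Pt} (h : cross2 a b = 0) : cross2 b a = 0 := by
  unfold cross2 at *; linarith

/-- Two distinct points of a line determine it. -/
lemma linePts_eq (A : Finset Pt) {ξ η u w : Pt} (h : ξ ≠ η) (huw : u ≠ w)
    (hu : cross2 (η - ξ) (u - ξ) = 0) (hw : cross2 (η - ξ) (w - ξ) = 0) :
    linePts A u w = linePts A ξ η := by
  have hd : η - ξ ≠ 0 := sub_ne_zero.2 h.symm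
  have he : w - u ≠ 0 := sub_ne_zero.2 huw.symm
  have hde : cross2 (η - ξ) (w - u) = 0 := by
    have : cross2 (η - ξ) (w - u) = cross2 (η - ξ) (w - ξ) - cross2 (η - ξ) (u - ξ) := by
      simp [cross2]; ring
    rw [this, hu, hw, sub_zero]
  ext z
  have hz : cross2 (η - ξ) (z - u) = cross2 (η - ξ) (z - ξ) - cross2 (η - ξ) (u - ξ) := by
    simp [cross2]; ring
  rw [hu, sub_zero] at hz
  rw [mem_linePts, mem_linePts, ← hz]
  refine and_congr_right fun _ => ⟨fun hh => ?_, fun hh => cross2_eq_zero_trans hd hde hh⟩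
  exact cross2_eq_zero_trans he (cross2_comm_eq_zero hde) hh

/-- A linear functional that is injective on the lattice. -/
def genX (p : Pt) : ℝ := p.1 + √2 * p.2

/-- The second coordinate. -/
def genY (p : Pt) : ℝ := p.2

lemma genX_injective : Function.Injective genX := by
  intro p q h
  unfold genX at h
  have h2 : p.2 = q.2 := by
    by_contra hne
    have hne' : ((p.2 - q.2 : ℤ) : ℝ) ≠ 0 := by exact_mod_cast sub_ne_zero.2 hne
    refine irrational_sqrt_two ⟨((q.1 - p.1 : ℤ) : ℚ) / ((p.2 - q.2 : ℤ) : ℚ), ?_⟩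
    push_cast at hne' ⊢
    rw [div_eq_iff hne']
    linarith
  rw [h2, add_left_inj] at h
  exact Prod.ext (by exact_mod_cast h) h2

lemma segHeight_genX_eq_iff {e : Pt × Pt} (he : genX e.1 < genX e.2) (z : Pt) :
    segHeight genX genY e (genX z) = genY z ↔ cross2 (e.2 - e.1) (z - e.1) = 0 := by
  have h : genX e.2 - genX e.1 ≠ 0 := (sub_pos.2 he).ne'
  have hc : ((cross2 (e.2 - e.1) (z - e.1) : ℤ) : ℝ) =
      (genX e.2 - genX e.1) * (genY z - genY e.1) -
        (genY e.2 - genY e.1) * (genX z - genX e.1) := by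
    simp only [cross2, genX, genY, Prod.fst_sub, Prod.snd_sub]
    push_cast
    ring
  have hh : segHeight genX genY e (genX z) - genY z =
      -(((cross2 (e.2 - e.1) (z - e.1) : ℤ) : ℝ) / (genX e.2 - genX e.1)) := by
    rw [hc, segHeight, segSlope]
    field_simp
    ring
  rw [← sub_eq_zero, hh, neg_eq_zero, div_eq_zero_iff, or_iff_left h, Int.cast_eq_zero]

lemma segHeight_eq_of_two {α : Type*} {X Y : α → ℝ} {e f : α × α} {x₁ x₂ : ℝ} (hx : x₁ ≠ x₂)
    (h₁ : segHeight X Y e x₁ = segHeight X Y f x₁) (h₂ : segHeight X Y e x₂ = segHeight X Y f x₂) :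
    segHeight X Y e = segHeight X Y f := by
  have he := segHeight_sub (X := X) (Y := Y) e x₂ x₁
  have hf := segHeight_sub (X := X) (Y := Y) f x₂ x₁
  have hs : segSlope X Y e = segSlope X Y f :=
    mul_right_cancel₀ (sub_ne_zero.2 hx.symm) (by linarith)
  funext x
  rw [segHeight_sub e x x₁, segHeight_sub f x x₁, h₁, hs]

/-- The ordered pairs of distinct points of `A` whose line has between `k` and `2 * k - 1`
points of `A`. -/
def richPairs (A : Finset Pt) (k : ℕ) : Finset (Pt × Pt) :=
  (A ×ˢ A).filter fun e => e.1 ≠ e.2 ∧ k ≤ (linePts A e.1 e.2).card ∧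
    (linePts A e.1 e.2).card < 2 * k

open Classical in
/-- The pairs of points that are consecutive on a rich line. -/
def richEdges (A : Finset Pt) (k : ℕ) : Finset (Pt × Pt) :=
  (richPairs A k).filter fun e => genX e.1 < genX e.2 ∧
    ∀ z ∈ linePts A e.1 e.2, genX z ≤ genX e.1 ∨ genX e.2 ≤ genX z

variable {A : Finset Pt} {k : ℕ}

lemma mem_richEdges {e : Pt × Pt} : e ∈ richEdges A k ↔ (e.1 ∈ A ∧ e.2 ∈ A) ∧
    (k ≤ (linePts A e.1 e.2).card ∧ (linePts A e.1 e.2).card < 2 * k) ∧ genX e.1 < genX e.2 ∧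
    ∀ z ∈ linePts A e.1 e.2, genX z ≤ genX e.1 ∨ genX e.2 ≤ genX z := by
  simp only [richEdges, richPairs, Finset.mem_filter, Finset.mem_product]
  constructor
  · rintro ⟨⟨h1, h2, h3⟩, h4⟩
    exact ⟨h1, h3, h4⟩
  · rintro ⟨h1, h3, h4⟩
    exact ⟨⟨h1, fun h => h4.1.ne (by rw [h]), h3⟩, h4⟩

lemma isSegGraph_richEdges (A : Finset Pt) (k : ℕ) :
    IsSegGraph genX genY A (richEdges A k) := by
  refine ⟨genX_injective.injOn, fun e he => (mem_richEdges.1 he).1.1,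
    fun e he => (mem_richEdges.1 he).1.2, fun e he => (mem_richEdges.1 he).2.2.1, ?_⟩
  intro e he z hz h1 h2 h
  obtain ⟨-, -, hlt, hcons⟩ := mem_richEdges.1 he
  rcases hcons z (mem_linePts.2 ⟨hz, (segHeight_genX_eq_iff hlt z).1 h⟩) with h | h <;> linarith

lemma richEdges_eq_of_overlap {e f : Pt × Pt} (he : e ∈ richEdges A k) (hf : f ∈ richEdges A k)
    (hl : linePts A e.1 e.2 = linePts A f.1 f.2) {x : ℝ} (h1 : genX e.1 < x) (h2 : x < genX e.2)
    (h3 : genX f.1 < x) (h4 : x < genX f.2) : e = f := by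
  obtain ⟨he1, -, hlt, hcons⟩ := mem_richEdges.1 he
  obtain ⟨hf1, -, hlt', hcons'⟩ := mem_richEdges.1 hf
  have a1 := hcons f.1 (by rw [hl]; exact left_mem_linePts _ hf1.1)
  have a2 := hcons f.2 (by rw [hl]; exact right_mem_linePts _ hf1.2)
  have a3 := hcons' e.1 (by rw [← hl]; exact left_mem_linePts _ he1.1)
  have a4 := hcons' e.2 (by rw [← hl]; exact right_mem_linePts _ he1.2)
  refine Prod.ext (genX_injective ?_) (genX_injective ?_)
  · rcases a1 with a1 | a1 <;> rcases a3 with a3 | a3 <;> linarith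
  · rcases a2 with a2 | a2 <;> rcases a4 with a4 | a4 <;> linarith

lemma linePts_eq_of_segHeight_eq {e f : Pt × Pt} (he : genX e.1 < genX e.2)
    (hf : genX f.1 < genX f.2) (h : segHeight genX genY e = segHeight genX genY f) :
    linePts A e.1 e.2 = linePts A f.1 f.2 := by
  refine linePts_eq A (fun h => hf.ne (by rw [h])) (fun h => he.ne (by rw [h])) ?_ ?_
  · rw [← segHeight_genX_eq_iff hf, ← h, segHeight_left]
  · rw [← segHeight_genX_eq_iff hf, ← h, segHeight_right he]

lemma segHeight_eq_of_linePts_eq {e f : Pt × Pt} (he : genX e.1 < genX e.2)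
    (hf : genX f.1 < genX f.2) (hf1 : f.1 ∈ A) (hf2 : f.2 ∈ A)
    (h : linePts A e.1 e.2 = linePts A f.1 f.2) :
    segHeight genX genY e = segHeight genX genY f := by
  have h1 := left_mem_linePts f.2 hf1
  have h2 := right_mem_linePts f.1 hf2
  rw [← h, mem_linePts, ← segHeight_genX_eq_iff he] at h1 h2
  refine segHeight_eq_of_two hf.ne ?_ ?_
  · rw [h1.2, segHeight_left]
  · rw [h2.2, segHeight_right hf]

lemma linePts_ne_of_cross {e f : Pt × Pt} (he : e ∈ richEdges A k) (hf : f ∈ richEdges A k)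
    (hne : e ≠ f) (h : SegCross genX genY e f) : linePts A e.1 e.2 ≠ linePts A f.1 f.2 := by
  obtain ⟨x, h1, h2, h3, h4, -⟩ := h
  exact fun hl => hne (richEdges_eq_of_overlap he hf hl h1 h3 h2 h4)

lemma ends_ne_of_cross {e f : Pt × Pt} (he : e ∈ richEdges A k) (hf : f ∈ richEdges A k)
    (hne : e ≠ f) (h : SegCross genX genY e f) : e.1 ≠ f.1 ∧ e.2 ≠ f.2 := by
  have hl := linePts_ne_of_cross he hf hne h
  have lt_e := (mem_richEdges.1 he).2.2.1
  have lt_f := (mem_richEdges.1 hf).2.2.1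
  obtain ⟨x, h1, h2, h3, h4, h5⟩ := h
  constructor
  · intro hh
    refine hl (linePts_eq_of_segHeight_eq lt_e lt_f (segHeight_eq_of_two h1.ne ?_ h5))
    rw [segHeight_left, hh, segHeight_left]
  · intro hh
    refine hl (linePts_eq_of_segHeight_eq lt_e lt_f (segHeight_eq_of_two h3.ne' ?_ h5))
    rw [segHeight_right lt_e, hh, segHeight_right lt_f]

open Classical in
/-- The sets cut out of `A` by the rich lines. -/
def richLines (A : Finset Pt) (k : ℕ) : Finset (Finset Pt) :=
  (richPairs A k).image fun e => linePts A e.1 e.2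

lemma richEdges_subset : richEdges A k ⊆ richPairs A k := by
  classical exact Finset.filter_subset _ _

lemma card_crossings_le :
    (crossings genX genY (richEdges A k)).card ≤ (richLines A k).card ^ 2 := by
  classical
  rw [sq, ← Finset.card_product]
  refine Finset.card_le_card_of_injOn
    (fun q => (linePts A q.1.1 q.1.2, linePts A q.2.1 q.2.2)) ?_ ?_
  · rintro ⟨e, f⟩ hq
    simp only [crossings, Finset.coe_filter, Finset.mem_product, Set.mem_ofPred_eq] at hq
    have hq' := hq.1
    exact Finset.mem_product.2 ⟨Finset.mem_image_of_mem _ (richEdges_subset hq'.1),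
      Finset.mem_image_of_mem _ (richEdges_subset hq'.2)⟩
  · rintro ⟨e, f⟩ hq ⟨e', f'⟩ hq' h
    simp only [crossings, Finset.coe_filter, Finset.mem_product, Set.mem_ofPred_eq] at hq hq'
    obtain ⟨⟨he, hf⟩, hne, hcr⟩ := hq
    obtain ⟨⟨he', hf'⟩, hne', hcr'⟩ := hq'
    simp only [Prod.mk.injEq] at h
    have hl := linePts_ne_of_cross he hf hne hcr
    have lt_e := (mem_richEdges.1 he).2.2.1
    have lt_f := (mem_richEdges.1 hf).2.2.1
    have Me := mem_richEdges.1 he'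
    have Mf := mem_richEdges.1 hf'
    have E1 := segHeight_eq_of_linePts_eq lt_e Me.2.2.1 Me.1.1 Me.1.2 h.1
    have E2 := segHeight_eq_of_linePts_eq lt_f Mf.2.2.1 Mf.1.1 Mf.1.2 h.2
    obtain ⟨x, a1, a2, a3, a4, a5⟩ := hcr
    obtain ⟨x', b1, b2, b3, b4, b5⟩ := hcr'
    have hx : x = x' := by
      by_contra hx
      refine hl (linePts_eq_of_segHeight_eq lt_e lt_f (segHeight_eq_of_two hx a5 ?_))
      rw [E1, E2, b5]
    subst hx
    rw [richEdges_eq_of_overlap he he' h.1 a1 a3 b1 b3,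
      richEdges_eq_of_overlap hf hf' h.2 a2 a4 b2 b4]

lemma card_richLines_mul_le : (richLines A k).card * (k - 1) ≤ (richEdges A k).card := by
  classical
  rw [mul_comm]
  have hmap : ∀ e ∈ richEdges A k, linePts A e.1 e.2 ∈ richLines A k :=
    fun e he => Finset.mem_image_of_mem _ (richEdges_subset he)
  refine Finset.mul_card_image_le_card_of_maps_to hmap (k - 1) ?_
  intro ℓ hℓ
  obtain ⟨⟨u, w⟩, hp, rfl⟩ := Finset.mem_image.1 hℓ
  simp only [richPairs, Finset.mem_filter, Finset.mem_product] at hp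
  obtain ⟨⟨hu, hw⟩, hne, hk⟩ := hp
  set ℓ := linePts A u w with hℓ
  obtain ⟨z, hz, hmax⟩ := Finset.exists_max_image ℓ genX ⟨u, left_mem_linePts w hu⟩
  have hnext : ∀ t, ∃ s, t ∈ ℓ.erase z → s ∈ ℓ ∧ genX t < genX s ∧
      ∀ r ∈ ℓ, genX r ≤ genX t ∨ genX s ≤ genX r := by
    intro t
    by_cases ht : t ∈ ℓ.erase z
    · obtain ⟨htz, htl⟩ := Finset.mem_erase.1 ht
      have hlt : genX t < genX z := lt_of_le_of_ne (hmax t htl) fun h => htz (genX_injective h)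
      obtain ⟨s, hs, hmin⟩ := Finset.exists_min_image (ℓ.filter fun s => genX t < genX s) genX
        ⟨z, by simp [hz, hlt]⟩
      rw [Finset.mem_filter] at hs
      refine ⟨s, fun _ => ⟨hs.1, hs.2, fun r hr => ?_⟩⟩
      rcases le_or_gt (genX r) (genX t) with h | h
      · exact Or.inl h
      · exact Or.inr (hmin r (Finset.mem_filter.2 ⟨hr, h⟩))
    · exact ⟨t, fun h => absurd h ht⟩
  choose nx hnx using hnext
  have hcard : (ℓ.erase z).card = ℓ.card - 1 := Finset.card_erase_of_mem hz
  have hle : (ℓ.erase z).card ≤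
      ((richEdges A k).filter fun e => linePts A e.1 e.2 = ℓ).card := by
    refine Finset.card_le_card_of_injOn (fun t => (t, nx t)) ?_ fun t _ s _ h =>
      (Prod.mk.inj h).1
    intro t ht
    obtain ⟨h1, h2, h3⟩ := hnx t ht
    have htl := Finset.mem_of_mem_erase ht
    have h4 : linePts A t (nx t) = ℓ := linePts_eq A hne (fun h => h2.ne (by rw [← h]))
      (mem_linePts.1 htl).2 (mem_linePts.1 h1).2
    simp only [Finset.coe_filter, Set.mem_ofPred_eq, mem_richEdges, h4]
    exact ⟨⟨⟨(mem_linePts.1 htl).1, (mem_linePts.1 h1).1⟩, hk, h2, h3⟩, trivial⟩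
  omega

lemma card_richPairs_le_mul : (richPairs A k).card ≤ (2 * k) ^ 2 * (richLines A k).card := by
  classical
  refine Finset.card_le_mul_card_image _ _ fun ℓ hℓ => ?_
  obtain ⟨p, hp, rfl⟩ := Finset.mem_image.1 hℓ
  have hp' := (Finset.mem_filter.1 hp).2.2.2
  refine le_trans (Finset.card_le_card (t := linePts A p.1 p.2 ×ˢ linePts A p.1 p.2) ?_) ?_
  · intro q hq
    obtain ⟨hq, heq⟩ := Finset.mem_filter.1 hq
    have hqA := Finset.mem_product.1 (Finset.mem_filter.1 hq).1
    rw [← heq]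
    exact Finset.mem_product.2 ⟨left_mem_linePts _ hqA.1, right_mem_linePts _ hqA.2⟩
  · rw [Finset.card_product, ← sq]
    exact Nat.pow_le_pow_left hp'.le 2

/-- A form of the Szemerédi–Trotter theorem. -/
theorem card_richPairs_le (A : Finset Pt) {k : ℕ} (hk : 2 ≤ k) :
    ((richPairs A k).card : ℝ) ≤ 6400 * (A.card : ℝ) ^ 2 / k + 80 * A.card * k := by
  have h1 : ((richPairs A k).card : ℝ) ≤ (2 * k) ^ 2 * (richLines A k).card := by
    exact_mod_cast card_richPairs_le_mul
  have h2 : ((richLines A k).card : ℝ) * (k - 1) ≤ (richEdges A k).card := by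
    have := card_richLines_mul_le (A := A) (k := k)
    rw [← Nat.cast_one, ← Nat.cast_sub (by omega)]
    exact_mod_cast this
  have h3 : ((crossings genX genY (richEdges A k)).card : ℝ) ≤ (richLines A k).card ^ 2 := by
    exact_mod_cast card_crossings_le
  have hk2 : (2 : ℝ) ≤ k := by exact_mod_cast hk
  have hG := isSegGraph_richEdges A k
  have h4 : (10 * (A.card : ℝ) ≤ (richEdges A k).card →
      ((richEdges A k).card : ℝ) ^ 3 ≤
        200 * (A.card : ℝ) ^ 2 * (crossings genX genY (richEdges A k)).card) := fun h =>
    hG.card_pow_three_le (fun e he f hf => ends_ne_of_cross he hf) (by exact_mod_cast h)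
  generalize ((richPairs A k).card : ℝ) = p at *
  have hL : (0 : ℝ) ≤ (richLines A k).card := by positivity
  generalize ((richLines A k).card : ℝ) = L at *
  generalize ((richEdges A k).card : ℝ) = e at *
  generalize ((crossings genX genY (richEdges A k)).card : ℝ) = r at *
  have hn : (0 : ℝ) ≤ A.card := by positivity
  generalize (A.card : ℝ) = n at *
  generalize (k : ℝ) = k at *
  have hk0 : 0 < k := by linarith
  have h5 : L * (k / 2) ≤ e := le_trans (mul_le_mul_of_nonneg_left (by linarith) hL) h2
  rcases lt_or_ge e (10 * n) with he | he
  · have : p ≤ 80 * n * k := by nlinarith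
    have : 0 ≤ 6400 * n ^ 2 / k := by positivity
    linarith
  · have h6 := h4 he
    have h7 : (L * (k / 2)) ^ 3 ≤ e ^ 3 := pow_le_pow_left₀ (by positivity) h5 3
    have h8 : L ^ 2 * (L * k ^ 3) ≤ L ^ 2 * (1600 * n ^ 2) := by nlinarith [sq_nonneg n]
    have h9 : L * k ^ 3 ≤ 1600 * n ^ 2 := by
      rcases hL.eq_or_lt with h0 | h0
      · rw [← h0]; nlinarith [sq_nonneg n]
      · exact le_of_mul_le_mul_left h8 (by positivity)
    have h10 : p ≤ 6400 * n ^ 2 / k := by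
      rw [le_div_iff₀ hk0]
      nlinarith
    have : 0 ≤ 80 * n * k := by positivity
    linarith

end RichLines

section PairSum

lemma sum_pow_inv_quarter_le (n : ℕ) :
    ∑ a ∈ Finset.range n, (((2 : ℝ) ^ a) ^ (-(1 / 4) : ℝ)) ≤ (1 - (2 : ℝ) ^ (-(1 / 4) : ℝ))⁻¹ := by
  have h1 : (2 : ℝ) ^ (-(1 / 4) : ℝ) < 1 :=
    Real.rpow_lt_one_of_one_lt_of_neg one_lt_two (by norm_num)
  have h0 : (0 : ℝ) ≤ (2 : ℝ) ^ (-(1 / 4) : ℝ) := by positivity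
  have h : ∀ a ∈ Finset.range n,
      (((2 : ℝ) ^ a) ^ (-(1 / 4) : ℝ)) = ((2 : ℝ) ^ (-(1 / 4) : ℝ)) ^ a := fun a _ => by
    rw [← Real.rpow_natCast, ← Real.rpow_natCast, ← Real.rpow_mul zero_le_two,
      ← Real.rpow_mul zero_le_two, mul_comm]
  rw [Finset.sum_congr rfl h, ← tsum_geometric_of_lt_one h0 h1]
  exact (summable_geometric_of_lt_one h0 h1).sum_le_tsum _ fun i _ => pow_nonneg h0 i

lemma two_le_card_linePts {A : Finset Pt} {ξ η : Pt} (hξ : ξ ∈ A) (hη : η ∈ A) (h : ξ ≠ η) :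
    2 ≤ (linePts A ξ η).card :=
  Finset.one_lt_card.2 ⟨ξ, left_mem_linePts η hξ, η, right_mem_linePts ξ hη, h⟩

/-- The pairs of points of `A` that span a line with fewer than `K` points. -/
def poorPairs (A : Finset Pt) (K : ℝ) : Finset (Pt × Pt) :=
  (A ×ˢ A).filter fun e => e.1 ≠ e.2 ∧ ((linePts A e.1 e.2).card : ℝ) < K

lemma sum_poorPairs_dyadic_le {A : Finset Pt} {K L : ℝ} (hA : (A.card : ℝ) ≤ L) (hL : 0 ≤ L)
    {M : ℝ} (hM : K ^ 2 ≤ M * L) (a : ℕ) :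
    ∑ e ∈ (poorPairs A K).filter fun e => Nat.log 2 (linePts A e.1 e.2).card = a,
      ((linePts A e.1 e.2).card : ℝ) ^ (3 / 4 : ℝ) ≤
      (2 * (6400 + 80 * M) * L ^ 2) * ((2 : ℝ) ^ a) ^ (-(1 / 4) : ℝ) := by
  set F := (poorPairs A K).filter fun e => Nat.log 2 (linePts A e.1 e.2).card = a with hF
  have hmem : ∀ e ∈ F, e.1 ∈ A ∧ e.2 ∈ A ∧ e.1 ≠ e.2 ∧ ((linePts A e.1 e.2).card : ℝ) < K ∧
      2 ^ a ≤ (linePts A e.1 e.2).card ∧ (linePts A e.1 e.2).card < 2 * 2 ^ a ∧ 1 ≤ a := by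
    intro e he
    simp only [hF, poorPairs, Finset.mem_filter, Finset.mem_product] at he
    obtain ⟨⟨⟨h1, h2⟩, h3, h4⟩, h5⟩ := he
    have h6 := two_le_card_linePts h1 h2 h3
    refine ⟨h1, h2, h3, h4, h5 ▸ Nat.pow_log_le_self 2 (by omega), ?_, ?_⟩
    · rw [← pow_succ', ← h5]
      exact Nat.lt_pow_succ_log_self one_lt_two _
    · exact h5 ▸ Nat.log_pos one_lt_two h6
  rcases F.eq_empty_or_nonempty with h0 | ⟨e₀, he₀⟩
  · have hM' : 0 ≤ M * L := (sq_nonneg K).trans hM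
    rw [h0, Finset.sum_empty]
    have : (6400 + 80 * M) * L ^ 2 = 6400 * L ^ 2 + 80 * (M * L) * L := by ring
    rw [mul_assoc 2, this]
    positivity
  obtain ⟨-, -, -, h4, h5, -, h7⟩ := hmem e₀ he₀
  have hk : (2 : ℕ) ≤ 2 ^ a := by
    calc 2 = 2 ^ 1 := rfl
      _ ≤ 2 ^ a := Nat.pow_le_pow_right two_pos h7
  have hcard : (F.card : ℝ) ≤ 6400 * (A.card : ℝ) ^ 2 / (2 ^ a : ℕ) + 80 * A.card * (2 ^ a : ℕ) := by
    refine le_trans ?_ (card_richPairs_le A hk)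
    have : F ⊆ richPairs A (2 ^ a) := by
      intro e he
      obtain ⟨h1, h2, h3, -, h5, h6, -⟩ := hmem e he
      simp only [richPairs, Finset.mem_filter, Finset.mem_product]
      exact ⟨⟨h1, h2⟩, h3, h5, h6⟩
    exact_mod_cast Finset.card_le_card this
  have hterm : ∀ e ∈ F, ((linePts A e.1 e.2).card : ℝ) ^ (3 / 4 : ℝ) ≤
      2 * ((2 : ℝ) ^ a) ^ (3 / 4 : ℝ) := by
    intro e he
    obtain ⟨-, -, -, -, -, h6, -⟩ := hmem e he
    calc ((linePts A e.1 e.2).card : ℝ) ^ (3 / 4 : ℝ) ≤ (2 * (2 : ℝ) ^ a) ^ (3 / 4 : ℝ) := by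
          refine Real.rpow_le_rpow (by positivity) ?_ (by norm_num)
          exact_mod_cast h6.le
      _ = 2 ^ (3 / 4 : ℝ) * ((2 : ℝ) ^ a) ^ (3 / 4 : ℝ) :=
          Real.mul_rpow zero_le_two (by positivity)
      _ ≤ 2 * ((2 : ℝ) ^ a) ^ (3 / 4 : ℝ) := by
          gcongr
          calc (2 : ℝ) ^ (3 / 4 : ℝ) ≤ 2 ^ (1 : ℝ) :=
                Real.rpow_le_rpow_of_exponent_le one_le_two (by norm_num)
            _ = 2 := Real.rpow_one 2
  push_cast at hcard
  set p : ℝ := 2 ^ a with hp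
  have hp0 : 0 < p := by positivity
  have hpK : p ≤ K := by
    refine le_trans ?_ h4.le
    rw [hp]
    exact_mod_cast h5
  have hpL : p ^ 2 ≤ M * L := le_trans (by gcongr) hM
  have hbound : (F.card : ℝ) ≤ (6400 + 80 * M) * L ^ 2 / p := by
    refine hcard.trans ?_
    have h1 : 80 * (A.card : ℝ) * p ≤ 80 * M * L ^ 2 / p := by
      rw [le_div_iff₀ hp0]
      calc 80 * (A.card : ℝ) * p * p = 80 * A.card * p ^ 2 := by ring
        _ ≤ 80 * L * (M * L) := by gcongr
        _ = 80 * M * L ^ 2 := by ring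
    calc 6400 * (A.card : ℝ) ^ 2 / p + 80 * A.card * p
        ≤ 6400 * L ^ 2 / p + 80 * M * L ^ 2 / p := by gcongr
      _ = (6400 + 80 * M) * L ^ 2 / p := by ring
  calc ∑ e ∈ F, ((linePts A e.1 e.2).card : ℝ) ^ (3 / 4 : ℝ)
      ≤ ∑ _e ∈ F, 2 * p ^ (3 / 4 : ℝ) := Finset.sum_le_sum hterm
    _ = F.card * (2 * p ^ (3 / 4 : ℝ)) := by rw [Finset.sum_const, nsmul_eq_mul]
    _ ≤ (6400 + 80 * M) * L ^ 2 / p * (2 * p ^ (3 / 4 : ℝ)) := by gcongr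
    _ = 2 * (6400 + 80 * M) * L ^ 2 * (p ^ (3 / 4 : ℝ) / p ^ (1 : ℝ)) := by
        rw [Real.rpow_one]; ring
    _ = 2 * (6400 + 80 * M) * L ^ 2 * p ^ (-(1 / 4) : ℝ) := by
        rw [← Real.rpow_sub hp0]; norm_num

lemma sum_poorPairs_le {A : Finset Pt} {K L : ℝ} (hA : (A.card : ℝ) ≤ L) (hL : 0 ≤ L)
    {M : ℝ} (hM0 : 0 ≤ M) (hM : K ^ 2 ≤ M * L) :
    ∑ e ∈ poorPairs A K, ((linePts A e.1 e.2).card : ℝ) ^ (3 / 4 : ℝ) ≤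
      2 * (6400 + 80 * M) * (1 - (2 : ℝ) ^ (-(1 / 4) : ℝ))⁻¹ * L ^ 2 := by
  have hmaps : ∀ e ∈ poorPairs A K,
      Nat.log 2 (linePts A e.1 e.2).card ∈ Finset.range (A.card + 1) := fun e _ => by
    rw [Finset.mem_range, Nat.lt_succ_iff]
    exact (Nat.log_le_self 2 _).trans (Finset.card_le_card (Finset.filter_subset _ _))
  rw [← Finset.sum_fiberwise_of_maps_to hmaps]
  refine (Finset.sum_le_sum fun a _ => sum_poorPairs_dyadic_le hA hL hM a).trans ?_
  rw [← Finset.mul_sum, mul_right_comm]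
  gcongr
  exact sum_pow_inv_quarter_le _

end PairSum

section LineWeights

lemma linePts_eq_of_cross2 (A : Finset Pt) {ξ η ζ : Pt} (hη : η ≠ ξ) (hζ : ζ ≠ ξ)
    (h : cross2 (η - ξ) (ζ - ξ) = 0) : linePts A ξ ζ = linePts A ξ η :=
  linePts_eq A hη.symm hζ.symm (by simp [cross2]) h

/-- The total weight of each punctured line through `ξ` is at most `M`. -/
def LineBounded (ξ : Pt) (T : Finset Pt) (w : Pt → ℝ) (M : ℝ) : Prop :=
  ∀ v : Pt, v ≠ 0 → ∑ ζ ∈ T.filter (fun ζ => ζ ≠ ξ ∧ cross2 v (ζ - ξ) = 0), w ζ ≤ M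

lemma card_filter_le_card_linePts (T : Finset Pt) {ξ η v : Pt} (hv : v ≠ 0)
    (h : cross2 v (η - ξ) = 0) :
    (T.filter (fun ζ => ζ ≠ ξ ∧ cross2 v (ζ - ξ) = 0)).card ≤ (linePts T ξ η).card := by
  refine Finset.card_le_card fun ζ hζ => ?_
  obtain ⟨h1, -, h3⟩ := Finset.mem_filter.1 hζ
  exact mem_linePts.2 ⟨h1, cross2_eq_zero_trans hv h h3⟩

lemma linePts_eq_of_mem_filter {T : Finset Pt} {ξ v η ζ : Pt} (hv : v ≠ 0) (A : Finset Pt)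
    (hη : η ∈ T.filter fun ζ => ζ ≠ ξ ∧ cross2 v (ζ - ξ) = 0)
    (hζ : ζ ∈ T.filter fun ζ => ζ ≠ ξ ∧ cross2 v (ζ - ξ) = 0) :
    linePts A ξ ζ = linePts A ξ η := by
  obtain ⟨-, h2, h3⟩ := Finset.mem_filter.1 hη
  obtain ⟨-, h2', h3'⟩ := Finset.mem_filter.1 hζ
  exact linePts_eq_of_cross2 A h2 h2' (cross2_eq_zero_trans hv h3 h3')

lemma lineBounded_inv_card (ξ : Pt) (T : Finset Pt) :
    LineBounded ξ T (fun η => ((linePts T ξ η).card : ℝ)⁻¹) 1 := by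
  intro v hv
  set F := T.filter fun ζ => ζ ≠ ξ ∧ cross2 v (ζ - ξ) = 0 with hF
  rcases F.eq_empty_or_nonempty with h0 | ⟨η, hη⟩
  · rw [h0, Finset.sum_empty]
    exact zero_le_one
  have hc : ∀ ζ ∈ F, ((linePts T ξ ζ).card : ℝ)⁻¹ = ((linePts T ξ η).card : ℝ)⁻¹ := fun ζ hζ => by
    rw [linePts_eq_of_mem_filter hv T hη hζ]
  have hle := card_filter_le_card_linePts T hv
    (Finset.mem_filter.1 hη).2.2
  rw [Finset.sum_congr rfl hc, Finset.sum_const, nsmul_eq_mul, ← div_eq_mul_inv]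
  exact div_le_one_of_le₀ (by exact_mod_cast hle) (by positivity)

lemma gcdP_pos {a : Pt} (h : a ≠ 0) : 0 < gcdP a := by
  unfold gcdP
  rw [Nat.pos_iff_ne_zero, Ne, Int.gcd_eq_zero_iff]
  exact fun h' => h (Prod.ext h'.1 h'.2)

lemma natAbs_eq_of_cross2 {a b : Pt} (h : cross2 a b = 0) (hg : gcdP a = gcdP b) (hb : b ≠ 0) :
    a.1.natAbs = b.1.natAbs ∧ a.2.natAbs = b.2.natAbs := by
  have hpos := gcdP_pos hb
  unfold cross2 gcdP at *
  have e : a.1 * b.2 = a.2 * b.1 := by linarith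
  constructor
  · refine Nat.eq_of_mul_eq_mul_right hpos ?_
    rw [← Int.gcd_mul_left, e, Int.gcd_mul_right, hg, mul_comm]
  · refine Nat.eq_of_mul_eq_mul_right hpos ?_
    rw [← Int.gcd_mul_left, ← e, Int.gcd_mul_right, hg, mul_comm]

lemma eq_or_eq_neg_of_cross2 {a b : Pt} (h : cross2 a b = 0) (hg : gcdP a = gcdP b) (hb : b ≠ 0) :
    a = b ∨ a = -b := by
  obtain ⟨h1, h2⟩ := natAbs_eq_of_cross2 h hg hb
  rw [Int.natAbs_eq_natAbs_iff] at h1 h2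
  unfold cross2 at h
  simp only [Prod.ext_iff, Prod.fst_neg, Prod.snd_neg]
  rcases h1 with h1 | h1 <;> rcases h2 with h2 | h2
  · exact Or.inl ⟨h1, h2⟩
  · have : b.1 * b.2 = 0 := by
      rw [h1, h2] at h
      linarith
    rcases mul_eq_zero.1 this with h | h <;> simp [h1, h2, h]
  · have : b.1 * b.2 = 0 := by
      rw [h1, h2] at h
      linarith
    rcases mul_eq_zero.1 this with h | h <;> simp [h1, h2, h]
  · exact Or.inr ⟨h1, h2⟩

lemma sum_inv_gcdP_sq_le (ξ : Pt) (T : Finset Pt) {v : Pt} (hv : v ≠ 0) :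
    ∑ ζ ∈ T.filter (fun ζ => ζ ≠ ξ ∧ cross2 v (ζ - ξ) = 0), ((gcdP (ξ - ζ) : ℝ) ^ 2)⁻¹ ≤ 4 := by
  set F := T.filter fun ζ => ζ ≠ ξ ∧ cross2 v (ζ - ξ) = 0 with hF
  set n := F.sup fun ζ => gcdP (ξ - ζ)
  have hmaps : ∀ ζ ∈ F, gcdP (ξ - ζ) ∈ Finset.Ioo 0 (n + 1) := fun ζ hζ => by
    refine Finset.mem_Ioo.2 ⟨gcdP_pos (sub_ne_zero.2 (Finset.mem_filter.1 hζ).2.1.symm), ?_⟩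
    exact Nat.lt_succ_of_le (Finset.le_sup (f := fun ζ => gcdP (ξ - ζ)) hζ)
  rw [← Finset.sum_fiberwise_of_maps_to hmaps]
  have hfib : ∀ g ∈ Finset.Ioo 0 (n + 1),
      ∑ ζ ∈ F.filter (fun ζ => gcdP (ξ - ζ) = g), ((gcdP (ξ - ζ) : ℝ) ^ 2)⁻¹ ≤
        2 * ((g : ℝ) ^ 2)⁻¹ := by
    intro g _
    have h1 : ∀ ζ ∈ F.filter (fun ζ => gcdP (ξ - ζ) = g),
        ((gcdP (ξ - ζ) : ℝ) ^ 2)⁻¹ = ((g : ℝ) ^ 2)⁻¹ := fun ζ hζ => by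
      rw [(Finset.mem_filter.1 hζ).2]
    rw [Finset.sum_congr rfl h1, Finset.sum_const, nsmul_eq_mul]
    refine mul_le_mul_of_nonneg_right ?_ (by positivity)
    rcases (F.filter fun ζ => gcdP (ξ - ζ) = g).eq_empty_or_nonempty with h0 | ⟨η, hη⟩
    · rw [h0]; simp
    have hsub : F.filter (fun ζ => gcdP (ξ - ζ) = g) ⊆ {η, 2 • ξ - η} := by
      intro ζ hζ
      obtain ⟨hη1, hη2⟩ := Finset.mem_filter.1 hη
      obtain ⟨hζ1, hζ2⟩ := Finset.mem_filter.1 hζ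
      obtain ⟨-, hη3, hη4⟩ := Finset.mem_filter.1 hη1
      obtain ⟨-, hζ3, hζ4⟩ := Finset.mem_filter.1 hζ1
      have hc : cross2 (ξ - ζ) (ξ - η) = 0 := by
        have := cross2_eq_zero_trans hv hζ4 hη4
        simp only [cross2, Prod.fst_sub, Prod.snd_sub] at this ⊢
        linarith
      rw [Finset.mem_insert, Finset.mem_singleton]
      rcases eq_or_eq_neg_of_cross2 hc (hζ2.trans hη2.symm) (sub_ne_zero.2 hη3.symm) with h | h
      · exact Or.inl (sub_right_injective h)
      · right
        have : ζ = ξ - (ξ - ζ) := by abel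
        rw [this, h]
        abel
    exact_mod_cast (Finset.card_le_card hsub).trans Finset.card_le_two
  refine (Finset.sum_le_sum hfib).trans ?_
  rw [← Finset.mul_sum]
  have := sum_Ioo_inv_sq_le (α := ℝ) 0 (n + 1)
  norm_num at this ⊢
  linarith

lemma lineBounded_inv_gcdP (ξ : Pt) (T : Finset Pt) :
    LineBounded ξ T (fun ζ => ((gcdP (ξ - ζ) : ℝ) * √(linePts T ξ ζ).card)⁻¹) 2 := by
  intro v hv
  have hsq := sum_inv_gcdP_sq_le ξ T hv
  set F := T.filter fun ζ => ζ ≠ ξ ∧ cross2 v (ζ - ξ) = 0 with hF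
  rcases F.eq_empty_or_nonempty with h0 | ⟨η, hη⟩
  · rw [h0, Finset.sum_empty]
    exact zero_le_two
  have hc : ∀ ζ ∈ F, ((gcdP (ξ - ζ) : ℝ) * √(linePts T ξ ζ).card)⁻¹ =
      (gcdP (ξ - ζ) : ℝ)⁻¹ * (√(linePts T ξ η).card)⁻¹ := fun ζ hζ => by
    rw [linePts_eq_of_mem_filter hv T hη hζ, mul_inv]
  have hle : (F.card : ℝ) ≤ (linePts T ξ η).card := by
    exact_mod_cast card_filter_le_card_linePts T hv
      (Finset.mem_filter.1 hη).2.2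
  rw [Finset.sum_congr rfl hc, ← Finset.sum_mul]
  have hpos : (0 : ℝ) < (linePts T ξ η).card := by
    refine lt_of_lt_of_le ?_ hle
    exact_mod_cast Finset.card_pos.2 ⟨η, hη⟩
  rw [← div_eq_mul_inv, div_le_iff₀ (Real.sqrt_pos.2 hpos)]
  refine le_of_sq_le_sq ?_ (by positivity)
  calc (∑ ζ ∈ F, (gcdP (ξ - ζ) : ℝ)⁻¹) ^ 2
      ≤ F.card * ∑ ζ ∈ F, ((gcdP (ξ - ζ) : ℝ)⁻¹) ^ 2 := sq_sum_le_card_mul_sum_sq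
    _ ≤ (linePts T ξ η).card * 4 := by
        gcongr
        simpa only [inv_pow] using hsq
    _ = (2 * √(linePts T ξ η).card) ^ 2 := by
        rw [mul_pow, Real.sq_sqrt hpos.le]; ring

end LineWeights

section CenterSum

/-- Weights that are bounded on lines through `ξ` can be transferred to the points of `A`. -/
lemma sum_lineBounded_le {A T : Finset Pt} {ξ : Pt} {w : Pt → ℝ} {M : ℝ} (hξ : ξ ∈ A)
    (hw : LineBounded ξ T w M) (hw0 : ∀ ζ, 0 ≤ w ζ) {φ : ℕ → ℝ} (hφ : ∀ n, 0 ≤ φ n)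
    (hφ1 : φ 1 = 0) :
    ∑ ζ ∈ T.filter (fun ζ => ζ ≠ ξ), φ (linePts A ξ ζ).card * w ζ ≤
      2 * M * ∑ η ∈ A.filter (fun η => η ≠ ξ),
        φ (linePts A ξ η).card / (linePts A ξ η).card := by
  have h1 : ∀ ζ ∈ T.filter (fun ζ => ζ ≠ ξ), φ (linePts A ξ ζ).card * w ζ ≤
      ∑ η ∈ A.filter (fun η => η ≠ ξ), if cross2 (η - ξ) (ζ - ξ) = 0 then
        2 * (φ (linePts A ξ η).card / (linePts A ξ η).card) * w ζ else 0 := by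
    intro ζ hζ
    have hζξ := (Finset.mem_filter.1 hζ).2
    rw [← Finset.sum_filter]
    set F := (A.filter fun η => η ≠ ξ).filter fun η => cross2 (η - ξ) (ζ - ξ) = 0 with hF
    have hc : ∀ η ∈ F, 2 * (φ (linePts A ξ η).card / (linePts A ξ η).card) * w ζ =
        2 * (φ (linePts A ξ ζ).card / (linePts A ξ ζ).card) * w ζ := by
      intro η hη
      obtain ⟨hη1, hη2⟩ := Finset.mem_filter.1 hη
      rw [linePts_eq_of_cross2 A (Finset.mem_filter.1 hη1).2 hζξ hη2]
    have hFe : F = (linePts A ξ ζ).erase ξ := by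
      ext η
      simp only [hF, Finset.mem_filter, Finset.mem_erase, mem_linePts]
      constructor
      · rintro ⟨⟨a, b⟩, c⟩
        exact ⟨b, a, cross2_comm_eq_zero c⟩
      · rintro ⟨b, a, c⟩
        exact ⟨⟨a, b⟩, cross2_comm_eq_zero c⟩
    have hmem := left_mem_linePts (A := A) ζ hξ
    have hFc : F.card + 1 = (linePts A ξ ζ).card := by
      rw [hFe, Finset.card_erase_add_one hmem]
    rw [Finset.sum_congr rfl hc, Finset.sum_const, nsmul_eq_mul, ← hFc]
    rcases F.card.eq_zero_or_pos with h0 | h0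
    · rw [h0, zero_add, hφ1]; simp
    · have h0' : (1 : ℝ) ≤ F.card := by exact_mod_cast h0
      have := mul_nonneg (hφ (F.card + 1)) (hw0 ζ)
      have h2 : 1 ≤ (F.card : ℝ) * 2 / (F.card + 1) := by
        rw [le_div_iff₀ (by positivity)]; linarith
      calc φ (F.card + 1) * w ζ = 1 * (φ (F.card + 1) * w ζ) := (one_mul _).symm
        _ ≤ (F.card : ℝ) * 2 / (F.card + 1) * (φ (F.card + 1) * w ζ) := by gcongr
        _ = _ := by push_cast; ring
  refine (Finset.sum_le_sum h1).trans ?_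
  rw [Finset.sum_comm, Finset.mul_sum]
  refine Finset.sum_le_sum fun η hη => ?_
  have hηξ : η - ξ ≠ 0 := sub_ne_zero.2 (Finset.mem_filter.1 hη).2
  rw [← Finset.sum_filter, ← Finset.mul_sum, Finset.filter_filter]
  have hφn : 0 ≤ φ (linePts A ξ η).card / (linePts A ξ η).card := div_nonneg (hφ _) (by positivity)
  calc 2 * (φ (linePts A ξ η).card / (linePts A ξ η).card) * _
      ≤ 2 * (φ (linePts A ξ η).card / (linePts A ξ η).card) * M := by
        gcongr
        exact hw _ hηξ
    _ = _ := by ring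

/-- The dot product of two lattice vectors. -/
def dot2 (a b : Pt) : ℤ := a.1 * b.1 + a.2 * b.2

lemma sum_perp_le {T : Finset Pt} {ξ η : Pt} {w : Pt → ℝ} {M : ℝ} (hw : LineBounded ξ T w M)
    (hη : η ≠ ξ) :
    ∑ ζ ∈ T.filter (fun ζ => ζ ≠ ξ ∧ dot2 (η - ξ) (ζ - ξ) = 0), w ζ ≤ M := by
  have hd : η - ξ ≠ 0 := sub_ne_zero.2 hη
  have h := hw (-(η - ξ).2, (η - ξ).1) fun h => hd <| by
    rw [Prod.ext_iff] at h
    exact Prod.ext h.2 (neg_eq_zero.1 h.1)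
  refine le_of_eq_of_le (Finset.sum_congr (Finset.filter_congr fun ζ _ => ?_) fun _ _ => rfl) h
  refine and_congr_right fun _ => ?_
  rw [← neg_eq_zero]
  simp only [dot2, cross2]
  constructor <;> intro h <;> linarith

lemma sum_cross_le {A B D : Finset Pt} {ξ : Pt} {u w : Pt → ℝ} {M M' : ℝ} (hξ : ξ ∈ A)
    (hu : LineBounded ξ B u M) (hw : LineBounded ξ D w M') (hu0 : ∀ ζ, 0 ≤ u ζ)
    (hw0 : ∀ ζ, 0 ≤ w ζ) (hM : 0 ≤ M) (hM' : 0 ≤ M') {φ : ℕ → ℝ} (hφ : ∀ n, 0 ≤ φ n)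
    (hφ1 : φ 1 = 0) :
    ∑ p ∈ (B ×ˢ D).filter (fun p => p.1 ≠ ξ ∧ p.2 ≠ ξ ∧ dot2 (p.1 - ξ) (p.2 - ξ) = 0),
      (φ (linePts A ξ p.1).card + φ (linePts A ξ p.2).card) * (u p.1 * w p.2) ≤
      4 * M * M' * ∑ η ∈ A.filter (fun η => η ≠ ξ),
        φ (linePts A ξ η).card / (linePts A ξ η).card := by
  have hB := sum_lineBounded_le hξ hu hu0 hφ hφ1
  have hD := sum_lineBounded_le hξ hw hw0 hφ hφ1
  have h1 : ∑ p ∈ (B ×ˢ D).filter (fun p => p.1 ≠ ξ ∧ p.2 ≠ ξ ∧ dot2 (p.1 - ξ) (p.2 - ξ) = 0),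
      φ (linePts A ξ p.1).card * (u p.1 * w p.2) ≤
      M' * ∑ η ∈ B.filter (fun η => η ≠ ξ), φ (linePts A ξ η).card * u η := by
    rw [Finset.sum_filter, Finset.sum_product, Finset.mul_sum, Finset.sum_filter]
    refine Finset.sum_le_sum fun η _ => ?_
    by_cases hη : η = ξ
    · simp [hη]
    simp only [ne_eq, hη, not_false_eq_true, true_and, if_true]
    rw [← Finset.sum_filter]
    calc _ = (φ (linePts A ξ η).card * u η) *
          ∑ ζ ∈ D.filter (fun ζ => ζ ≠ ξ ∧ dot2 (η - ξ) (ζ - ξ) = 0), w ζ := by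
          rw [Finset.mul_sum]
          exact Finset.sum_congr rfl fun _ _ => by ring
      _ ≤ (φ (linePts A ξ η).card * u η) * M' :=
          mul_le_mul_of_nonneg_left (sum_perp_le hw hη) (mul_nonneg (hφ _) (hu0 _))
      _ = _ := mul_comm _ _
  have h2 : ∑ p ∈ (B ×ˢ D).filter (fun p => p.1 ≠ ξ ∧ p.2 ≠ ξ ∧ dot2 (p.1 - ξ) (p.2 - ξ) = 0),
      φ (linePts A ξ p.2).card * (u p.1 * w p.2) ≤
      M * ∑ ζ ∈ D.filter (fun ζ => ζ ≠ ξ), φ (linePts A ξ ζ).card * w ζ := by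
    rw [Finset.sum_filter, Finset.sum_product_right, Finset.mul_sum, Finset.sum_filter]
    refine Finset.sum_le_sum fun ζ _ => ?_
    by_cases hζ : ζ = ξ
    · simp [hζ]
    simp only [ne_eq, hζ, not_false_eq_true, true_and, if_true]
    rw [← Finset.sum_filter]
    calc _ = (φ (linePts A ξ ζ).card * w ζ) *
          ∑ η ∈ B.filter (fun η => η ≠ ξ ∧ dot2 (ζ - ξ) (η - ξ) = 0), u η := by
          rw [Finset.mul_sum]
          refine Finset.sum_congr (Finset.filter_congr fun η _ => and_congr_right fun _ => ?_)
            fun _ _ => by ring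
          simp only [dot2]
          constructor <;> intro h <;> linarith
      _ ≤ (φ (linePts A ξ ζ).card * w ζ) * M :=
          mul_le_mul_of_nonneg_left (sum_perp_le hu hζ) (mul_nonneg (hφ _) (hw0 _))
      _ = _ := mul_comm _ _
  simp only [add_mul, Finset.sum_add_distrib]
  have h3 := mul_le_mul_of_nonneg_left hB hM'
  have h4 := mul_le_mul_of_nonneg_left hD hM
  linarith

/-- The number of points of `A` on the richer arm of the cross spanned by `ξ`, `η`, `ζ`. -/
def armMax (A : Finset Pt) (ξ η ζ : Pt) : ℕ :=
  max (linePts A ξ η).card (linePts A ξ ζ).card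

/-- The crosses with a center in `A` all of whose arms have fewer than `K` points of `A`. -/
def poorCrosses (A B D : Finset Pt) (K : ℝ) : Finset (Pt × Pt × Pt) :=
  (A ×ˢ B ×ˢ D).filter fun t => (t.2.1 ≠ t.1 ∧ t.2.2 ≠ t.1 ∧
    dot2 (t.2.1 - t.1) (t.2.2 - t.1) = 0) ∧
    2 ≤ armMax A t.1 t.2.1 t.2.2 ∧ (armMax A t.1 t.2.1 t.2.2 : ℝ) < K

lemma sum_poorCrosses_le (A B D : Finset Pt) {K L : ℝ} (hA : (A.card : ℝ) ≤ L) (hL : 0 ≤ L)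
    {M : ℝ} (hM0 : 0 ≤ M) (hM : K ^ 2 ≤ M * L) :
    ∑ t ∈ poorCrosses A B D K, (armMax A t.1 t.2.1 t.2.2 : ℝ) ^ (7 / 4 : ℝ) *
      (((linePts B t.1 t.2.1).card : ℝ)⁻¹ *
        ((gcdP (t.1 - t.2.2) : ℝ) * √(linePts D t.1 t.2.2).card)⁻¹) ≤
      16 * (6400 + 80 * M) * (1 - (2 : ℝ) ^ (-(1 / 4) : ℝ))⁻¹ * L ^ 2 := by
  classical
  set φ : ℕ → ℝ := fun n => if 2 ≤ n ∧ (n : ℝ) < K then (n : ℝ) ^ (7 / 4 : ℝ) else 0 with hφ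
  have hφ0 : ∀ n, 0 ≤ φ n := fun n => by
    simp only [hφ]
    split_ifs <;> positivity
  have hφ1 : φ 1 = 0 := by simp [hφ]
  have hmax : ∀ a b : ℕ, 2 ≤ max a b → ((max a b : ℕ) : ℝ) < K →
      ((max a b : ℕ) : ℝ) ^ (7 / 4 : ℝ) ≤ φ a + φ b := by
    intro a b h1 h2
    rcases max_choice a b with h | h <;> rw [h] at h1 h2 ⊢
    · have : φ a = (a : ℝ) ^ (7 / 4 : ℝ) := if_pos ⟨h1, h2⟩
      linarith [hφ0 b]
    · have : φ b = (b : ℝ) ^ (7 / 4 : ℝ) := if_pos ⟨h1, h2⟩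
      linarith [hφ0 a]
  set u : Pt → Pt → ℝ := fun ξ η => ((linePts B ξ η).card : ℝ)⁻¹
  set w : Pt → Pt → ℝ := fun ξ ζ => ((gcdP (ξ - ζ) : ℝ) * √(linePts D ξ ζ).card)⁻¹
  have hu0 : ∀ ξ η, 0 ≤ u ξ η := fun ξ η => by positivity
  have hw0 : ∀ ξ η, 0 ≤ w ξ η := fun ξ η => by positivity
  calc ∑ t ∈ poorCrosses A B D K, (armMax A t.1 t.2.1 t.2.2 : ℝ) ^ (7 / 4 : ℝ) *
        (u t.1 t.2.1 * w t.1 t.2.2)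
      ≤ ∑ t ∈ poorCrosses A B D K, (φ (linePts A t.1 t.2.1).card + φ (linePts A t.1 t.2.2).card) *
        (u t.1 t.2.1 * w t.1 t.2.2) := by
        refine Finset.sum_le_sum fun t ht => ?_
        have ht' := (Finset.mem_filter.1 ht).2.2
        exact mul_le_mul_of_nonneg_right (hmax _ _ ht'.1 ht'.2) (mul_nonneg (hu0 _ _) (hw0 _ _))
    _ ≤ ∑ t ∈ (A ×ˢ B ×ˢ D).filter (fun t => t.2.1 ≠ t.1 ∧ t.2.2 ≠ t.1 ∧
          dot2 (t.2.1 - t.1) (t.2.2 - t.1) = 0),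
        (φ (linePts A t.1 t.2.1).card + φ (linePts A t.1 t.2.2).card) *
        (u t.1 t.2.1 * w t.1 t.2.2) := by
        refine Finset.sum_le_sum_of_subset_of_nonneg ?_ fun t _ _ =>
          mul_nonneg (add_nonneg (hφ0 _) (hφ0 _)) (mul_nonneg (hu0 _ _) (hw0 _ _))
        exact fun t ht => Finset.mem_filter.2
          ⟨(Finset.mem_filter.1 ht).1, (Finset.mem_filter.1 ht).2.1⟩
    _ = ∑ ξ ∈ A, ∑ p ∈ (B ×ˢ D).filter (fun p => p.1 ≠ ξ ∧ p.2 ≠ ξ ∧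
          dot2 (p.1 - ξ) (p.2 - ξ) = 0),
        (φ (linePts A ξ p.1).card + φ (linePts A ξ p.2).card) * (u ξ p.1 * w ξ p.2) := by
        rw [Finset.sum_filter, Finset.sum_product]
        exact Finset.sum_congr rfl fun ξ _ => (Finset.sum_filter _ _).symm
    _ ≤ ∑ ξ ∈ A, 4 * 1 * 2 * ∑ η ∈ A.filter (fun η => η ≠ ξ),
        φ (linePts A ξ η).card / (linePts A ξ η).card :=
        Finset.sum_le_sum fun ξ hξ => sum_cross_le hξ (lineBounded_inv_card ξ B)
          (lineBounded_inv_gcdP ξ D) (hu0 ξ) (hw0 ξ) zero_le_one zero_le_two hφ0 hφ1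
    _ = 8 * ∑ e ∈ poorPairs A K, ((linePts A e.1 e.2).card : ℝ) ^ (3 / 4 : ℝ) := by
        rw [← Finset.mul_sum]
        norm_num only
        congr 1
        rw [poorPairs, Finset.sum_filter, Finset.sum_product]
        refine Finset.sum_congr rfl fun ξ hξ => ?_
        rw [Finset.sum_filter]
        refine Finset.sum_congr rfl fun η hη => ?_
        by_cases h : η = ξ
        · simp [h]
        have h2 := two_le_card_linePts hξ hη (Ne.symm h)
        have hpos : (0 : ℝ) < (linePts A ξ η).card := by
          exact_mod_cast lt_of_lt_of_le two_pos h2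
        simp only [ne_eq, h, Ne.symm h, not_false_eq_true, if_true, true_and, hφ, h2]
        split_ifs
        · nth_rewrite 2 [← Real.rpow_one ((linePts A ξ η).card : ℝ)]
          rw [← Real.rpow_sub hpos]
          norm_num
        · simp
    _ ≤ 8 * (2 * (6400 + 80 * M) * (1 - (2 : ℝ) ^ (-(1 / 4) : ℝ))⁻¹ * L ^ 2) := by
        gcongr
        exact sum_poorPairs_le hA hL hM0 hM
    _ = _ := by ring

end CenterSum

section Rectangles

/-- The weight of a vertex with `N` points on its cross, whose neighbors have `N'` and `N''`. -/
def vertexWeight (N N' N'' : ℕ) : ℝ := (N : ℝ) ^ (7 / 4 : ℝ) * ((N' : ℝ)⁻¹ * (√N'')⁻¹)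

lemma sum_vertexWeight_le {R : Finset Quad} {A B D : Finset Pt} {K L M : ℝ}
    (hA : (A.card : ℝ) ≤ L) (hL : 0 ≤ L) (hM0 : 0 ≤ M) (hM : K ^ 2 ≤ M * L)
    {x y z : Quad → Pt} {g N' N'' : Quad → ℕ}
    (hinj : Set.InjOn (fun Q => (x Q, y Q, z Q)) R)
    (hmem : ∀ Q ∈ R, (x Q, y Q, z Q) ∈ poorCrosses A B D K)
    (hg : ∀ Q ∈ R, gcdP (x Q - z Q) = g Q)
    (hN' : ∀ Q ∈ R, (linePts B (x Q) (y Q)).card ≤ N' Q)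
    (hN'' : ∀ Q ∈ R, (linePts D (x Q) (z Q)).card ≤ N'' Q) :
    ∑ Q ∈ R, (g Q : ℝ)⁻¹ * vertexWeight (armMax A (x Q) (y Q) (z Q)) (N' Q) (N'' Q) ≤
      16 * (6400 + 80 * M) * (1 - (2 : ℝ) ^ (-(1 / 4) : ℝ))⁻¹ * L ^ 2 := by
  classical
  refine le_trans ?_ (sum_poorCrosses_le A B D hA hL hM0 hM)
  set G : Pt × Pt × Pt → ℝ := fun t => (armMax A t.1 t.2.1 t.2.2 : ℝ) ^ (7 / 4 : ℝ) *
      (((linePts B t.1 t.2.1).card : ℝ)⁻¹ *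
        ((gcdP (t.1 - t.2.2) : ℝ) * √(linePts D t.1 t.2.2).card)⁻¹) with hG
  calc _ ≤ ∑ Q ∈ R, G (x Q, y Q, z Q) := by
        refine Finset.sum_le_sum fun Q hQ => ?_
        have h := hmem Q hQ
        simp only [poorCrosses, Finset.mem_filter, Finset.mem_product] at h
        obtain ⟨⟨-, hB, hD⟩, -⟩ := h
        have h1 : (0 : ℝ) < (linePts B (x Q) (y Q)).card := by
          exact_mod_cast Finset.card_pos.2 ⟨_, right_mem_linePts _ hB⟩
        have h2 : (0 : ℝ) < (linePts D (x Q) (z Q)).card := by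
          exact_mod_cast Finset.card_pos.2 ⟨_, right_mem_linePts _ hD⟩
        have h3 : ((linePts B (x Q) (y Q)).card : ℝ) ≤ N' Q := by exact_mod_cast hN' Q hQ
        have h4 : ((linePts D (x Q) (z Q)).card : ℝ) ≤ N'' Q := by exact_mod_cast hN'' Q hQ
        rw [hG]
        dsimp only
        rw [hg Q hQ, mul_inv, vertexWeight]
        calc _ = (armMax A (x Q) (y Q) (z Q) : ℝ) ^ (7 / 4 : ℝ) *
              (((N' Q : ℕ) : ℝ)⁻¹ * ((g Q : ℝ)⁻¹ * (√(N'' Q))⁻¹)) := by ring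
          _ ≤ _ := by gcongr
    _ = ∑ t ∈ R.image (fun Q => (x Q, y Q, z Q)), G t := (Finset.sum_image hinj).symm
    _ ≤ _ := by
        refine Finset.sum_le_sum_of_subset_of_nonneg ?_ fun t _ _ => by positivity
        intro t ht
        obtain ⟨Q, hQ, rfl⟩ := Finset.mem_image.1 ht
        exact hmem Q hQ

lemma vertexWeight_eq {N N' N'' : ℕ} (h : 0 < N) (h' : 0 < N') (h'' : 0 < N'') (j : ℝ) :
    (2 : ℝ) ^ (-2 * j) * vertexWeight N N' N'' =
      2 ^ (7 / 4 * Real.logb 2 N - Real.logb 2 N' - Real.logb 2 N'' / 2 - 2 * j) := by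
  have e : ∀ n : ℕ, 0 < n → (2 : ℝ) ^ Real.logb 2 n = n := fun n hn =>
    Real.rpow_logb two_pos (by norm_num) (by exact_mod_cast hn)
  have e' : ∀ (n : ℕ) (s : ℝ), 0 < n → (2 : ℝ) ^ (Real.logb 2 n * s) = (n : ℝ) ^ s :=
    fun n s hn => by rw [Real.rpow_mul zero_le_two, e n hn]
  rw [Real.rpow_sub two_pos, Real.rpow_sub two_pos, Real.rpow_sub two_pos, mul_comm (7 / 4 : ℝ),
    div_eq_mul_one_div (Real.logb 2 (N'' : ℝ)), e' N _ h, e N' h', e' N'' _ h'',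
    ← Real.sqrt_eq_rpow, neg_mul, Real.rpow_neg zero_le_two, vertexWeight]
  ring

lemma exists_exponent_le {x₀ x₁ x₂ x₃ j₀ j₁ j₂ j₃ : ℝ} (h₀ : 0 ≤ x₀) (h₁ : 0 ≤ x₁) (h₂ : 0 ≤ x₂)
    (h₃ : 0 ≤ x₃) :
    -(j₀ + j₁ + j₂ + j₃) / 2 + (|j₀ - j₁| + |j₂ - j₃|) / 34 ≤ 7 / 4 * x₀ - x₁ - x₃ / 2 - 2 * j₀ ∨
    -(j₀ + j₁ + j₂ + j₃) / 2 + (|j₀ - j₁| + |j₂ - j₃|) / 34 ≤ 7 / 4 * x₁ - x₀ - x₂ / 2 - 2 * j₁ ∨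
    -(j₀ + j₁ + j₂ + j₃) / 2 + (|j₀ - j₁| + |j₂ - j₃|) / 34 ≤ 7 / 4 * x₂ - x₃ - x₁ / 2 - 2 * j₂ ∨
    -(j₀ + j₁ + j₂ + j₃) / 2 + (|j₀ - j₁| + |j₂ - j₃|) / 34 ≤
      7 / 4 * x₃ - x₂ - x₀ / 2 - 2 * j₃ := by
  by_contra! ⟨a₀, a₁, a₂, a₃⟩
  rcases le_total j₀ j₁ with h | h <;> rcases le_total j₂ j₃ with h' | h'
  · rw [abs_of_nonpos (sub_nonpos.2 h), abs_of_nonpos (sub_nonpos.2 h')] at *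
    rcases le_total j₀ j₂ with h'' | h'' <;> linarith
  · rw [abs_of_nonpos (sub_nonpos.2 h), abs_of_nonneg (sub_nonneg.2 h')] at *
    rcases le_total j₀ j₃ with h'' | h'' <;> linarith
  · rw [abs_of_nonneg (sub_nonneg.2 h), abs_of_nonpos (sub_nonpos.2 h')] at *
    rcases le_total j₁ j₂ with h'' | h'' <;> linarith
  · rw [abs_of_nonneg (sub_nonneg.2 h), abs_of_nonneg (sub_nonneg.2 h')] at *
    rcases le_total j₁ j₃ with h'' | h'' <;> linarith

lemma rpow_le_sum_vertexWeight {N₀ N₁ N₂ N₃ : ℕ} (h₀ : 0 < N₀) (h₁ : 0 < N₁) (h₂ : 0 < N₂)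
    (h₃ : 0 < N₃) (j₀ j₁ j₂ j₃ : ℝ) :
    (2 : ℝ) ^ (-(j₀ + j₁ + j₂ + j₃) / 2 + (|j₀ - j₁| + |j₂ - j₃|) / 34) ≤
      2 ^ (-2 * j₀) * vertexWeight N₀ N₁ N₃ + 2 ^ (-2 * j₁) * vertexWeight N₁ N₀ N₂ +
      2 ^ (-2 * j₂) * vertexWeight N₂ N₃ N₁ + 2 ^ (-2 * j₃) * vertexWeight N₃ N₂ N₀ := by
  rw [vertexWeight_eq h₀ h₁ h₃, vertexWeight_eq h₁ h₀ h₂, vertexWeight_eq h₂ h₃ h₁,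
    vertexWeight_eq h₃ h₂ h₀]
  have hl : ∀ n : ℕ, 0 < n → 0 ≤ Real.logb 2 (n : ℝ) := fun n hn =>
    Real.logb_nonneg one_lt_two (by exact_mod_cast hn)
  have hp : ∀ t : ℝ, 0 < (2 : ℝ) ^ t := fun t => Real.rpow_pos_of_pos two_pos t
  have key : ∀ {s t : ℝ}, s ≤ t → (2 : ℝ) ^ s ≤ 2 ^ t := fun h =>
    Real.rpow_le_rpow_of_exponent_le one_le_two h
  rcases exists_exponent_le (j₀ := j₀) (j₁ := j₁) (j₂ := j₂) (j₃ := j₃) (hl _ h₀) (hl _ h₁)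
    (hl _ h₂) (hl _ h₃) with h | h | h | h
  all_goals
    refine (key h).trans ?_
    linarith [hp (7 / 4 * Real.logb 2 N₀ - Real.logb 2 N₁ - Real.logb 2 N₃ / 2 - 2 * j₀),
      hp (7 / 4 * Real.logb 2 N₁ - Real.logb 2 N₀ - Real.logb 2 N₂ / 2 - 2 * j₁),
      hp (7 / 4 * Real.logb 2 N₂ - Real.logb 2 N₃ - Real.logb 2 N₁ / 2 - 2 * j₂),
      hp (7 / 4 * Real.logb 2 N₃ - Real.logb 2 N₂ - Real.logb 2 N₀ / 2 - 2 * j₃)]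

lemma lineCount_eq (A : Finset Pt) {ξ η : Pt} (h : ξ ≠ η) :
    lineCount (lineThrough ξ η) A = (linePts A ξ η).card := by
  have hinj : Function.Injective emb := fun p q hpq => by
    simp only [emb, Prod.mk.injEq, Int.cast_inj] at hpq
    exact Prod.ext hpq.1 hpq.2
  have hs : lineThrough ξ η ∩ (emb '' (A : Set Pt)) = emb '' (linePts A ξ η : Set Pt) := by
    ext x
    constructor
    · rintro ⟨⟨t, ht⟩, z, hz, rfl⟩
      refine ⟨z, Finset.mem_coe.2 (mem_linePts.2 ⟨Finset.mem_coe.1 hz, ?_⟩), rfl⟩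
      simp only [emb, Prod.ext_iff, Prod.fst_add, Prod.snd_add, Prod.smul_fst, Prod.smul_snd,
        Prod.fst_sub, Prod.snd_sub, smul_eq_mul] at ht
      have : ((cross2 (η - ξ) (z - ξ) : ℤ) : ℝ) = 0 := by
        simp only [cross2, Prod.fst_sub, Prod.snd_sub]
        push_cast
        rw [ht.1, ht.2]
        ring
      exact_mod_cast this
    · rintro ⟨z, hz, rfl⟩
      obtain ⟨hzA, hc⟩ := mem_linePts.1 (Finset.mem_coe.1 hz)
      refine ⟨?_, z, hzA, rfl⟩
      have hc' : ((cross2 (η - ξ) (z - ξ) : ℤ) : ℝ) = 0 := by exact_mod_cast hc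
      simp only [cross2, Prod.fst_sub, Prod.snd_sub] at hc'
      push_cast at hc'
      by_cases h1 : η.1 = ξ.1
      · have h2 : ((η.2 : ℝ) - ξ.2) ≠ 0 := by
          refine sub_ne_zero.2 fun h2 => h (Prod.ext h1.symm ?_)
          exact_mod_cast h2.symm
        refine ⟨((z.2 : ℝ) - ξ.2) / (η.2 - ξ.2), ?_⟩
        simp only [emb, Prod.ext_iff, Prod.fst_add, Prod.snd_add, Prod.smul_fst, Prod.smul_snd,
          Prod.fst_sub, Prod.snd_sub, smul_eq_mul]
        constructor <;> field_simp <;> linarith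
      · have h2 : ((η.1 : ℝ) - ξ.1) ≠ 0 := by
          refine sub_ne_zero.2 fun h2 => h1 ?_
          exact_mod_cast h2
        refine ⟨((z.1 : ℝ) - ξ.1) / (η.1 - ξ.1), ?_⟩
        simp only [emb, Prod.ext_iff, Prod.fst_add, Prod.snd_add, Prod.smul_fst, Prod.smul_snd,
          Prod.fst_sub, Prod.snd_sub, smul_eq_mul]
        constructor <;> field_simp <;> linarith
  rw [lineCount, hs, Set.ncard_image_of_injective _ hinj, Set.ncard_coe_finset]

end Rectangles

section Levels

lemma linePts_comm (A : Finset Pt) {ξ η : Pt} (h : ξ ≠ η) : linePts A ξ η = linePts A η ξ :=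
  linePts_eq A h.symm h (by simp [cross2, mul_comm]) (by simp [cross2])

lemma gcdP_neg (a : Pt) : gcdP (-a) = gcdP a := by
  simp [gcdP]

/-- The rectangles with a vertex in each of the sets `A k`, such that the cross at the
`k`-th vertex has an arm with at least two points and no arm with `K k` points. -/
structure LevelRect (A : Fin 4 → Finset Pt) (K : Fin 4 → ℝ) (Q : Quad) : Prop where
  para : IsPara Q
  dot : dotQ Q = 0
  inj : Function.Injective Q
  mem : ∀ k, Q k ∈ A k
  poor₀ : 2 ≤ armMax (A 0) (Q 0) (Q 1) (Q 3) ∧ (armMax (A 0) (Q 0) (Q 1) (Q 3) : ℝ) < K 0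
  poor₁ : 2 ≤ armMax (A 1) (Q 1) (Q 0) (Q 2) ∧ (armMax (A 1) (Q 1) (Q 0) (Q 2) : ℝ) < K 1
  poor₂ : 2 ≤ armMax (A 2) (Q 2) (Q 3) (Q 1) ∧ (armMax (A 2) (Q 2) (Q 3) (Q 1) : ℝ) < K 2
  poor₃ : 2 ≤ armMax (A 3) (Q 3) (Q 2) (Q 0) ∧ (armMax (A 3) (Q 3) (Q 2) (Q 0) : ℝ) < K 3

lemma IsPara.eq_of_three {Q Q' : Quad} (h : IsPara Q) (h' : IsPara Q') (e : Fin 4)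
    (heq : ∀ i, i ≠ e → Q i = Q' i) : Q = Q' := by
  unfold IsPara at h h'
  have key : Q e = Q' e := by
    fin_cases e
    · have h1 := heq 1 (by decide)
      have h2 := heq 2 (by decide)
      have h3 := heq 3 (by decide)
      rw [h1, h2, h3, ← h'] at h
      exact add_right_cancel h
    · have h1 := heq 0 (by decide)
      have h2 := heq 2 (by decide)
      have h3 := heq 3 (by decide)
      rw [h1, h2, h3, h'] at h
      exact (add_right_cancel h).symm
    · have h1 := heq 0 (by decide)
      have h2 := heq 1 (by decide)
      have h3 := heq 3 (by decide)
      rw [h1, h2, h3, ← h'] at h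
      exact add_left_cancel h
    · have h1 := heq 0 (by decide)
      have h2 := heq 1 (by decide)
      have h3 := heq 2 (by decide)
      rw [h1, h2, h3, h'] at h
      exact (add_left_cancel h).symm
  funext i
  by_cases hi : i = e
  · rw [hi, key]
  · exact heq i hi

lemma IsPara.sub_eq {Q : Quad} (h : IsPara Q) : Q 1 - Q 2 = Q 0 - Q 3 := by
  unfold IsPara at h
  rw [sub_eq_sub_iff_add_eq_add, ← h]

/-- The constant in the bound for the rectangles with prescribed levels. -/
def levelConst (C : ℕ) : ℝ := 16 * (6400 + 80 * 4 ^ C) * (1 - (2 : ℝ) ^ (-(1 / 4) : ℝ))⁻¹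

lemma levelConst_nonneg (C : ℕ) : 0 ≤ levelConst C := by
  have h1 : (2 : ℝ) ^ (-(1 / 4) : ℝ) < 1 :=
    Real.rpow_lt_one_of_one_lt_of_neg one_lt_two (by norm_num)
  have := inv_nonneg.2 (sub_nonneg.2 h1.le)
  unfold levelConst
  positivity

variable {C : ℕ} {A : Fin 4 → Finset Pt} {J : Fin 4 → ℕ} {R : Finset Quad}

lemma sum_vertexWeight_level_le (hA : ∀ k, (A k).card ≤ 2 ^ J k)
    (hR : ∀ Q ∈ R, LevelRect A (fun k => (2 : ℝ) ^ ((J k : ℝ) / 2 + C)) Q) (k b d e : Fin 4)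
    (hkb : k ≠ b) (hkd : k ≠ d) (he : ∀ i, i ≠ e → i = k ∨ i = b ∨ i = d) {N N' N'' : Quad → ℕ}
    (hN : ∀ Q, N Q = armMax (A k) (Q k) (Q b) (Q d))
    (hpoor : ∀ Q ∈ R, 2 ≤ N Q ∧ (N Q : ℝ) < (2 : ℝ) ^ ((J k : ℝ) / 2 + C))
    (hdot : ∀ Q ∈ R, dot2 (Q b - Q k) (Q d - Q k) = 0)
    (hg : ∀ Q ∈ R, gcdP (Q k - Q d) = gcdP (Q 0 - Q 3))
    (hN' : ∀ Q, (linePts (A b) (Q b) (Q k)).card ≤ N' Q)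
    (hN'' : ∀ Q, (linePts (A d) (Q d) (Q k)).card ≤ N'' Q) :
    ∑ Q ∈ R, (gcdP (Q 0 - Q 3) : ℝ)⁻¹ * ((2 : ℝ) ^ (-2 * (J k : ℝ)) *
      vertexWeight (N Q) (N' Q) (N'' Q)) ≤ levelConst C := by
  have hK : ((2 : ℝ) ^ ((J k : ℝ) / 2 + C)) ^ 2 ≤ 4 ^ C * 2 ^ J k := by
    rw [Real.rpow_add two_pos, mul_pow, ← Real.rpow_natCast _ 2, ← Real.rpow_mul zero_le_two,
      Real.rpow_natCast, ← pow_mul, mul_comm C, pow_mul, mul_comm]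
    norm_num
  have h := sum_vertexWeight_le (R := R) (A := A k) (B := A b) (D := A d)
    (L := 2 ^ J k) (x := fun Q => Q k) (y := fun Q => Q b) (z := fun Q => Q d)
    (g := fun Q => gcdP (Q 0 - Q 3)) (N' := N') (N'' := N'') (by exact_mod_cast hA k)
    (by positivity) (by positivity) hK ?_ ?_ hg ?_ ?_
  · have hmul := mul_le_mul_of_nonneg_left h (by positivity : (0 : ℝ) ≤ 2 ^ (-2 * (J k : ℝ)))
    rw [Finset.mul_sum] at hmul
    refine le_trans (Finset.sum_le_sum fun Q _ => ?_) (hmul.trans_eq ?_)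
    · rw [hN, mul_left_comm]
    · have h2 : (2 : ℝ) ^ (-2 * (J k : ℝ)) * ((2 : ℝ) ^ J k) ^ 2 = 1 := by
        rw [neg_mul, Real.rpow_neg zero_le_two, mul_comm (2 : ℝ), Real.rpow_mul zero_le_two,
          Real.rpow_natCast, Real.rpow_two]
        exact inv_mul_cancel₀ (by positivity)
      rw [mul_left_comm, h2, mul_one, levelConst]
  · intro Q hQ Q' hQ' heq
    simp only [Prod.mk.injEq] at heq
    refine (hR Q hQ).para.eq_of_three (hR Q' hQ').para e fun i hi => ?_
    rcases he i hi with rfl | rfl | rfl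
    exacts [heq.1, heq.2.1, heq.2.2]
  · intro Q hQ
    have hq := hR Q hQ
    have hp := hpoor Q hQ
    rw [hN] at hp
    simp only [poorCrosses, Finset.mem_filter, Finset.mem_product]
    exact ⟨⟨hq.mem k, hq.mem b, hq.mem d⟩, ⟨hq.inj.ne hkb.symm, hq.inj.ne hkd.symm, hdot Q hQ⟩, hp⟩
  · intro Q hQ
    rw [linePts_comm _ ((hR Q hQ).inj.ne hkb)]
    exact hN' Q
  · intro Q hQ
    rw [linePts_comm _ ((hR Q hQ).inj.ne hkd)]
    exact hN'' Q

lemma sum_levelRect_le (hA : ∀ k, (A k).card ≤ 2 ^ J k)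
    (hR : ∀ Q ∈ R, LevelRect A (fun k => (2 : ℝ) ^ ((J k : ℝ) / 2 + C)) Q) :
    ∑ Q ∈ R, (gcdP (Q 0 - Q 3) : ℝ)⁻¹ ≤ 4 * levelConst C *
      (2 : ℝ) ^ (((J 0 : ℝ) + J 1 + J 2 + J 3) / 2 -
        (|(J 0 : ℝ) - J 1| + |(J 2 : ℝ) - J 3|) / 34) := by
  set N₀ : Quad → ℕ := fun Q => armMax (A 0) (Q 0) (Q 1) (Q 3) with hN₀
  set N₁ : Quad → ℕ := fun Q => armMax (A 1) (Q 1) (Q 0) (Q 2) with hN₁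
  set N₂ : Quad → ℕ := fun Q => armMax (A 2) (Q 2) (Q 3) (Q 1) with hN₂
  set N₃ : Quad → ℕ := fun Q => armMax (A 3) (Q 3) (Q 2) (Q 0) with hN₃
  have hdot : ∀ Q ∈ R, ((Q 0).1 - (Q 1).1) * ((Q 0).1 - (Q 3).1) +
      ((Q 0).2 - (Q 1).2) * ((Q 0).2 - (Q 3).2) = 0 := fun Q hQ => (hR Q hQ).dot
  have hpar : ∀ Q ∈ R, (Q 2).1 = (Q 1).1 + (Q 3).1 - (Q 0).1 ∧
      (Q 2).2 = (Q 1).2 + (Q 3).2 - (Q 0).2 := fun Q hQ => by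
    have := Prod.ext_iff.1 (hR Q hQ).para
    simp only [Prod.fst_add, Prod.snd_add] at this
    constructor <;> linarith
  have s₀ := sum_vertexWeight_level_le hA hR 0 1 3 2 (by decide) (by decide) (by decide)
    (N := N₀) (N' := N₁) (N'' := N₃) (fun _ => rfl) (fun Q hQ => (hR Q hQ).poor₀)
    (fun Q hQ => by
      simp only [dot2, Prod.fst_sub, Prod.snd_sub]
      linear_combination hdot Q hQ)
    (fun Q hQ => rfl) (fun Q => le_max_left _ _) (fun Q => le_max_right _ _)
  have s₁ := sum_vertexWeight_level_le hA hR 1 0 2 3 (by decide) (by decide) (by decide)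
    (N := N₁) (N' := N₀) (N'' := N₂) (fun _ => rfl) (fun Q hQ => (hR Q hQ).poor₁)
    (fun Q hQ => by
      simp only [dot2, Prod.fst_sub, Prod.snd_sub]
      rw [(hpar Q hQ).1, (hpar Q hQ).2]
      linear_combination -hdot Q hQ)
    (fun Q hQ => by rw [(hR Q hQ).para.sub_eq])
    (fun Q => le_max_left _ _) (fun Q => le_max_right _ _)
  have s₂ := sum_vertexWeight_level_le hA hR 2 3 1 0 (by decide) (by decide) (by decide)
    (N := N₂) (N' := N₃) (N'' := N₁) (fun _ => rfl) (fun Q hQ => (hR Q hQ).poor₂)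
    (fun Q hQ => by
      simp only [dot2, Prod.fst_sub, Prod.snd_sub]
      rw [(hpar Q hQ).1, (hpar Q hQ).2]
      linear_combination hdot Q hQ)
    (fun Q hQ => by rw [← neg_sub, gcdP_neg, (hR Q hQ).para.sub_eq])
    (fun Q => le_max_left _ _) (fun Q => le_max_right _ _)
  have s₃ := sum_vertexWeight_level_le hA hR 3 2 0 1 (by decide) (by decide) (by decide)
    (N := N₃) (N' := N₂) (N'' := N₀) (fun _ => rfl) (fun Q hQ => (hR Q hQ).poor₃)
    (fun Q hQ => by
      simp only [dot2, Prod.fst_sub, Prod.snd_sub]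
      rw [(hpar Q hQ).1, (hpar Q hQ).2]
      linear_combination -hdot Q hQ)
    (fun Q hQ => by rw [← neg_sub, gcdP_neg])
    (fun Q => le_max_left _ _) (fun Q => le_max_right _ _)
  set E : ℝ := -((J 0 : ℝ) + J 1 + J 2 + J 3) / 2 +
    (|(J 0 : ℝ) - J 1| + |(J 2 : ℝ) - J 3|) / 34 with hE
  have hE' : ((J 0 : ℝ) + J 1 + J 2 + J 3) / 2 -
        (|(J 0 : ℝ) - J 1| + |(J 2 : ℝ) - J 3|) / 34 = -E := by rw [hE]; ring
  rw [hE', Real.rpow_neg zero_le_two, ← div_eq_mul_inv,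
    le_div_iff₀ (Real.rpow_pos_of_pos two_pos E), Finset.sum_mul]
  refine le_trans (Finset.sum_le_sum fun Q hQ => mul_le_mul_of_nonneg_left
    (rpow_le_sum_vertexWeight (N₀ := N₀ Q) (N₁ := N₁ Q) (N₂ := N₂ Q) (N₃ := N₃ Q)
      (two_pos.trans_le (hR Q hQ).poor₀.1) (two_pos.trans_le (hR Q hQ).poor₁.1)
      (two_pos.trans_le (hR Q hQ).poor₂.1) (two_pos.trans_le (hR Q hQ).poor₃.1)
      (J 0) (J 1) (J 2) (J 3)) (by positivity)) ?_
  simp only [mul_add, Finset.sum_add_distrib]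
  linarith

end Levels

section Schur

lemma sum_pow_injOn_le {ι : Type*} {F : Finset ι} {e : ι → ℕ} (he : Set.InjOn e F) {r : ℝ}
    (h0 : 0 ≤ r) (h1 : r < 1) : ∑ i ∈ F, r ^ e i ≤ (1 - r)⁻¹ := by
  rw [← Finset.sum_image (f := fun n => r ^ n) he, ← tsum_geometric_of_lt_one h0 h1]
  exact (summable_geometric_of_lt_one h0 h1).sum_le_tsum _ fun i _ => pow_nonneg h0 i

lemma sum_pow_dist_le (n i : ℕ) {r : ℝ} (h0 : 0 ≤ r) (h1 : r < 1) :
    ∑ j ∈ Finset.range n, r ^ Nat.dist i j ≤ 2 * (1 - r)⁻¹ := by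
  rw [← Finset.sum_filter_add_sum_filter_not _ (fun j => j ≤ i), two_mul]
  refine add_le_add (sum_pow_injOn_le ?_ h0 h1) (sum_pow_injOn_le ?_ h0 h1)
  all_goals
    intro a ha b hb hab
    simp only [Finset.coe_filter, Finset.mem_range, Set.mem_ofPred_eq, Nat.dist] at ha hb hab
    omega

lemma sum_mul_pow_dist_le (n : ℕ) (lam : ℕ → ℝ) {r : ℝ} (h0 : 0 ≤ r) (h1 : r < 1) :
    ∑ p ∈ Finset.range n ×ˢ Finset.range n, lam p.1 * lam p.2 * r ^ Nat.dist p.1 p.2 ≤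
      2 * (1 - r)⁻¹ * ∑ j ∈ Finset.range n, lam j ^ 2 := by
  have h : ∑ i ∈ Finset.range n, ∑ j ∈ Finset.range n, lam i ^ 2 * r ^ Nat.dist i j ≤
      2 * (1 - r)⁻¹ * ∑ j ∈ Finset.range n, lam j ^ 2 := by
    rw [Finset.mul_sum]
    refine Finset.sum_le_sum fun i _ => ?_
    rw [← Finset.mul_sum, mul_comm]
    exact mul_le_mul_of_nonneg_right (sum_pow_dist_le n i h0 h1) (sq_nonneg _)
  have h' : ∑ i ∈ Finset.range n, ∑ j ∈ Finset.range n, lam j ^ 2 * r ^ Nat.dist i j ≤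
      2 * (1 - r)⁻¹ * ∑ j ∈ Finset.range n, lam j ^ 2 := by
    rw [Finset.sum_comm]
    simpa only [Nat.dist_comm] using h
  rw [Finset.sum_product]
  have hterm : ∀ i j, lam i * lam j * r ^ Nat.dist i j ≤
      lam i ^ 2 * r ^ Nat.dist i j / 2 + lam j ^ 2 * r ^ Nat.dist i j / 2 := fun i j => by
    have := mul_nonneg (sq_nonneg (lam i - lam j)) (pow_nonneg h0 (Nat.dist i j))
    linarith
  refine (Finset.sum_le_sum fun i _ => Finset.sum_le_sum fun j _ => hterm i j).trans ?_
  simp only [Finset.sum_add_distrib, ← Finset.sum_div]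
  linarith

lemma rpow_neg_abs_sub_div (i j : ℕ) :
    (2 : ℝ) ^ (-(|(i : ℝ) - j| / 34)) = ((2 : ℝ) ^ (-(1 / 34) : ℝ)) ^ Nat.dist i j := by
  have : ((Nat.dist i j : ℕ) : ℝ) = |(i : ℝ) - j| := by
    rcases le_total i j with h | h
    · have h' : (i : ℝ) ≤ j := by exact_mod_cast h
      rw [Nat.dist_eq_sub_of_le h, abs_of_nonpos (sub_nonpos.2 h'), Nat.cast_sub h, neg_sub]
    · have h' : (j : ℝ) ≤ i := by exact_mod_cast h
      rw [Nat.dist_eq_sub_of_le_right h, abs_of_nonneg (sub_nonneg.2 h'), Nat.cast_sub h]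
  rw [← Real.rpow_natCast, ← Real.rpow_mul zero_le_two, this]
  congr 1
  ring

end Schur

section Assembly

lemma fWt_eq {S : ℕ → Finset Pt} {lam : ℕ → ℝ} {m j : ℕ} {ξ : Pt}
    (hS : ∀ i ≤ m, ∀ j ≤ m, i ≠ j → Disjoint (S i) (S j)) (hj : j ≤ m) (hξ : ξ ∈ S j) :
    fWt S lam m ξ = lam j * (2 : ℝ) ^ (-(j : ℝ) / 2) := by
  rw [fWt, Finset.sum_eq_single j]
  · rw [if_pos hξ]
  · intro i hi hij
    refine if_neg fun h => ?_
    exact Finset.disjoint_left.1 (hS i (Nat.lt_succ_iff.1 (Finset.mem_range.1 hi)) j hj hij) h hξ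
  · intro h
    exact absurd (Finset.mem_range.2 (Nat.lt_succ_of_le hj)) h

lemma VertexType.mem {S : ℕ → Finset Pt} {C m α : ℕ} {ξ η ζ : Pt}
    (h : VertexType S C m α ξ η ζ) : ∃ j ≤ m, ξ ∈ S j := by
  obtain ⟨j, hj, hξ, -⟩ := h
  exact ⟨j, hj, hξ⟩

lemma VertexType.armMax_of_two {S : ℕ → Finset Pt} {C m j : ℕ} {ξ η ζ : Pt}
    (hS : ∀ i ≤ m, ∀ j ≤ m, i ≠ j → Disjoint (S i) (S j)) (hj : j ≤ m) (hξ : ξ ∈ S j)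
    (hη : ξ ≠ η) (hζ : ξ ≠ ζ) (h : VertexType S C m 2 ξ η ζ) :
    2 ≤ armMax (S j) ξ η ζ ∧ (armMax (S j) ξ η ζ : ℝ) < (2 : ℝ) ^ ((j : ℝ) / 2 + C) := by
  obtain ⟨i, hi, hξi, h⟩ := h
  have hij : i = j := by
    by_contra hij
    exact Finset.disjoint_left.1 (hS i hi j hj hij) hξi hξ
  subst hij
  rw [crossMax, lineCount_eq _ hη, lineCount_eq _ hζ] at h
  rcases h with h | h | h
  · exact absurd h.1 (by norm_num)
  · exact h.2
  · exact absurd h.1 (by norm_num)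

lemma armMax_comm (A : Finset Pt) (ξ η ζ : Pt) : armMax A ξ η ζ = armMax A ξ ζ η :=
  max_comm _ _

lemma levelRect_of_mem {S : ℕ → Finset Pt} {C m : ℕ} {J : Fin 4 → ℕ} {Q : Quad}
    (hS : ∀ i ≤ m, ∀ j ≤ m, i ≠ j → Disjoint (S i) (S j)) (hJ : ∀ k, J k ≤ m)
    (hQJ : ∀ k, Q k ∈ S (J k)) (hQ : Q ∈ QZeroAB S C m 2 2) :
    LevelRect (fun k => S (J k)) (fun k => (2 : ℝ) ^ ((J k : ℝ) / 2 + C)) Q := by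
  obtain ⟨⟨hp, hd⟩, hi, h0, h1, h2, h3⟩ := hQ
  have ne : ∀ i j : Fin 4, i ≠ j → Q i ≠ Q j := fun i j h => hi.ne h
  refine ⟨hp, hd, hi, hQJ, ?_, ?_, ?_, ?_⟩
  · exact h0.armMax_of_two hS (hJ 0) (hQJ 0) (ne _ _ (by decide)) (ne _ _ (by decide))
  · rw [armMax_comm]
    exact h1.armMax_of_two hS (hJ 1) (hQJ 1) (ne _ _ (by decide)) (ne _ _ (by decide))
  · exact h2.armMax_of_two hS (hJ 2) (hQJ 2) (ne _ _ (by decide)) (ne _ _ (by decide))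
  · rw [armMax_comm]
    exact h3.armMax_of_two hS (hJ 3) (hQJ 3) (ne _ _ (by decide)) (ne _ _ (by decide))

lemma sum_level_le {S : ℕ → Finset Pt} {lam : ℕ → ℝ} {C m : ℕ} {J : Fin 4 → ℕ} {R : Finset Quad}
    (hS : ∀ i ≤ m, ∀ j ≤ m, i ≠ j → Disjoint (S i) (S j))
    (hcard : ∀ j ≤ m, (S j).card ≤ 2 ^ j) (hlam : ∀ j ≤ m, 0 ≤ lam j) (hJ : ∀ k, J k ≤ m)
    (hR : ∀ Q ∈ R, (∀ k, Q k ∈ S (J k)) ∧ Q ∈ QZeroAB S C m 2 2) :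
    ∑ Q ∈ R, (1 / (gcdP (Q 0 - Q 3) : ℝ)) * fQ (fWt S lam m) Q ≤
      4 * levelConst C * ((lam (J 0) * lam (J 1) * 2 ^ (-(|(J 0 : ℝ) - J 1| / 34))) *
        (lam (J 2) * lam (J 3) * 2 ^ (-(|(J 2 : ℝ) - J 3| / 34)))) := by
  have hmain := sum_levelRect_le (C := C) (A := fun k => S (J k)) (J := J) (R := R)
    (fun k => hcard _ (hJ k)) fun Q hQ => levelRect_of_mem hS hJ (hR Q hQ).1 (hR Q hQ).2
  have hf : ∀ Q ∈ R, (1 / (gcdP (Q 0 - Q 3) : ℝ)) * fQ (fWt S lam m) Q =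
      (lam (J 0) * lam (J 1) * lam (J 2) * lam (J 3) *
        2 ^ (-((J 0 : ℝ) + J 1 + J 2 + J 3) / 2)) * (gcdP (Q 0 - Q 3) : ℝ)⁻¹ := by
    intro Q hQ
    have hq := (hR Q hQ).1
    have he : -((J 0 : ℝ) + J 1 + J 2 + J 3) / 2 =
        -(J 0 : ℝ) / 2 + -(J 1 : ℝ) / 2 + -(J 2 : ℝ) / 2 + -(J 3 : ℝ) / 2 := by ring
    rw [fQ, Fin.prod_univ_four, fWt_eq hS (hJ 0) (hq 0), fWt_eq hS (hJ 1) (hq 1),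
      fWt_eq hS (hJ 2) (hq 2), fWt_eq hS (hJ 3) (hq 3), he, Real.rpow_add two_pos,
      Real.rpow_add two_pos, Real.rpow_add two_pos]
    ring
  rw [Finset.sum_congr rfl hf, ← Finset.mul_sum]
  have l0 := hlam _ (hJ 0)
  have l1 := hlam _ (hJ 1)
  have l2 := hlam _ (hJ 2)
  have l3 := hlam _ (hJ 3)
  refine (mul_le_mul_of_nonneg_left hmain (by positivity)).trans_eq ?_
  have he : (2 : ℝ) ^ (-((J 0 : ℝ) + J 1 + J 2 + J 3) / 2) *
      2 ^ (((J 0 : ℝ) + J 1 + J 2 + J 3) / 2 - (|(J 0 : ℝ) - J 1| + |(J 2 : ℝ) - J 3|) / 34) =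
      2 ^ (-(|(J 0 : ℝ) - J 1| / 34)) * 2 ^ (-(|(J 2 : ℝ) - J 3| / 34)) := by
    rw [← Real.rpow_add two_pos, ← Real.rpow_add two_pos]
    congr 1
    ring
  calc _ = lam (J 0) * lam (J 1) * lam (J 2) * lam (J 3) * (4 * levelConst C) *
        (2 ^ (-((J 0 : ℝ) + J 1 + J 2 + J 3) / 2) * 2 ^ (((J 0 : ℝ) + J 1 + J 2 + J 3) / 2 -
          (|(J 0 : ℝ) - J 1| + |(J 2 : ℝ) - J 3|) / 34)) := by ring
    _ = _ := by
        rw [he]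
        ring

end Assembly

/-- **Estimate (3.7) of Lemma 3.3.**
`Σ_{Q ∈ 𝒬⁰_{2,2}} f(Q)/gcd(ξ₁−ξ₄) ≲ ‖λ‖_{ℓ²}⁴`. -/
theorem sum_QZeroAB_22_gcd_bound (C : ℕ) :
    ∃ c : ℝ, 0 < c ∧
      ∀ (m : ℕ) (S : ℕ → Finset Pt) (lam : ℕ → ℝ),
        1 ≤ m →
        (∀ i ≤ m, ∀ j ≤ m, i ≠ j → Disjoint (S i) (S j)) →
        (∀ j ≤ m, (S j).card ≤ 2 ^ j) →
        (∀ j ≤ m, 0 ≤ lam j) →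
        (∀ j ≤ m, ∀ ξ ∈ S j, ∀ ℓ₁ ℓ₂ : Set (ℝ × ℝ), IsLine ℓ₁ → IsLine ℓ₂ →
          emb ξ ∈ ℓ₁ → emb ξ ∈ ℓ₂ →
          (2 : ℝ) ^ ((j : ℝ) / 2 + (C : ℝ)) ≤ (lineCount ℓ₁ (S j) : ℝ) →
          (2 : ℝ) ^ ((j : ℝ) / 2 + (C : ℝ)) ≤ (lineCount ℓ₂ (S j) : ℝ) → ℓ₁ = ℓ₂) →
        ∑' Q : Quad, Set.indicator (QZeroAB S C m 2 2)
            (fun Q => (1 / (gcdP (Q 0 - Q 3) : ℝ)) * fQ (fWt S lam m) Q) Q ≤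
          c * (∑ j ∈ Finset.range (m + 1), lam j ^ 2) ^ 2 := by
  classical
  set r : ℝ := 2 ^ (-(1 / 34) : ℝ) with hr
  have hr0 : 0 ≤ r := by positivity
  have hr1 : r < 1 := Real.rpow_lt_one_of_one_lt_of_neg one_lt_two (by norm_num)
  have hr2 : 0 ≤ (1 - r)⁻¹ := inv_nonneg.2 (sub_nonneg.2 hr1.le)
  have hC := levelConst_nonneg C
  refine ⟨4 * levelConst C * (2 * (1 - r)⁻¹) ^ 2 + 1, by positivity, ?_⟩
  intro m S lam _ hS hcard hlam _
  have hlv : ∀ ξ : Pt, ∃ j, (∃ i ≤ m, ξ ∈ S i) → j ≤ m ∧ ξ ∈ S j := fun ξ => by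
    by_cases h : ∃ i ≤ m, ξ ∈ S i
    · obtain ⟨i, hi⟩ := h
      exact ⟨i, fun _ => hi⟩
    · exact ⟨0, fun h' => absurd h' h⟩
  choose lv hlv using hlv
  have hmem : ∀ Q ∈ QZeroAB S C m 2 2, ∀ k, lv (Q k) ≤ m ∧ Q k ∈ S (lv (Q k)) := by
    rintro Q ⟨-, -, h0, h1, h2, h3⟩ k
    refine hlv _ ?_
    fin_cases k
    exacts [h0.mem, h1.mem, h2.mem, h3.mem]
  set U := (Finset.range (m + 1)).biUnion S with hU
  set R := (Fintype.piFinset fun _ : Fin 4 => U).filter (· ∈ QZeroAB S C m 2 2) with hR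
  have hRmem : ∀ Q, Q ∈ QZeroAB S C m 2 2 → Q ∈ R := fun Q hQ => by
    refine Finset.mem_filter.2 ⟨Fintype.mem_piFinset.2 fun k => Finset.mem_biUnion.2 ?_, hQ⟩
    exact ⟨_, Finset.mem_range.2 (Nat.lt_succ_of_le (hmem Q hQ k).1), (hmem Q hQ k).2⟩
  rw [tsum_eq_sum (s := R) fun Q hQ => Set.indicator_of_notMem (fun h => hQ (hRmem Q h)) _]
  rw [Finset.sum_congr rfl fun Q hQ => Set.indicator_of_mem (Finset.mem_filter.1 hQ).2 _]
  set I := Finset.range (m + 1) with hI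
  have hmaps : ∀ Q ∈ R, ((lv (Q 0), lv (Q 1)), (lv (Q 2), lv (Q 3))) ∈ (I ×ˢ I) ×ˢ (I ×ˢ I) := by
    intro Q hQ
    have h := fun k => Finset.mem_range.2 (Nat.lt_succ_of_le
      (hmem Q (Finset.mem_filter.1 hQ).2 k).1)
    simp only [Finset.mem_product]
    exact ⟨⟨h 0, h 1⟩, h 2, h 3⟩
  rw [← Finset.sum_fiberwise_of_maps_to hmaps]
  have hlevel : ∀ t ∈ (I ×ˢ I) ×ˢ (I ×ˢ I),
      ∑ Q ∈ R.filter (fun Q => ((lv (Q 0), lv (Q 1)), (lv (Q 2), lv (Q 3))) = t),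
        (1 / (gcdP (Q 0 - Q 3) : ℝ)) * fQ (fWt S lam m) Q ≤
      4 * levelConst C * ((lam t.1.1 * lam t.1.2 * r ^ Nat.dist t.1.1 t.1.2) *
        (lam t.2.1 * lam t.2.2 * r ^ Nat.dist t.2.1 t.2.2)) := by
    rintro ⟨⟨j₀, j₁⟩, j₂, j₃⟩ ht
    simp only [Finset.mem_product, hI, Finset.mem_range, Nat.lt_succ_iff] at ht
    have h := sum_level_le (lam := lam) (C := C) (J := ![j₀, j₁, j₂, j₃]) (R := R.filter
      (fun Q => ((lv (Q 0), lv (Q 1)), (lv (Q 2), lv (Q 3))) = ((j₀, j₁), (j₂, j₃)))) hS hcard hlam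
      ?_ ?_
    · simpa only [Matrix.cons_val, rpow_neg_abs_sub_div] using h
    · intro k
      fin_cases k
      exacts [ht.1.1, ht.1.2, ht.2.1, ht.2.2]
    · intro Q hQ
      obtain ⟨hQR, hQt⟩ := Finset.mem_filter.1 hQ
      have hQ' := (Finset.mem_filter.1 hQR).2
      simp only [Prod.mk.injEq] at hQt
      obtain ⟨⟨rfl, rfl⟩, rfl, rfl⟩ := hQt
      refine ⟨fun k => ?_, hQ'⟩
      have := (hmem Q hQ' k).2
      fin_cases k <;> exact this
  refine (Finset.sum_le_sum hlevel).trans ?_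
  rw [← Finset.mul_sum, Finset.sum_product]
  dsimp only
  rw [← Finset.sum_mul_sum, ← sq]
  have hpos : 0 ≤ ∑ p ∈ I ×ˢ I, lam p.1 * lam p.2 * r ^ Nat.dist p.1 p.2 := by
    refine Finset.sum_nonneg fun p hp => ?_
    simp only [Finset.mem_product, hI, Finset.mem_range, Nat.lt_succ_iff] at hp
    exact mul_nonneg (mul_nonneg (hlam _ hp.1) (hlam _ hp.2)) (pow_nonneg hr0 _)
  have hsch := sum_mul_pow_dist_le (m + 1) lam hr0 hr1
  calc 4 * levelConst C * (∑ p ∈ I ×ˢ I, lam p.1 * lam p.2 * r ^ Nat.dist p.1 p.2) ^ 2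
      ≤ 4 * levelConst C * (2 * (1 - r)⁻¹ * ∑ j ∈ I, lam j ^ 2) ^ 2 := by gcongr
    _ = 4 * levelConst C * (2 * (1 - r)⁻¹) ^ 2 * (∑ j ∈ I, lam j ^ 2) ^ 2 := by ring
    _ ≤ _ := by
        gcongr
        linarith
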